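/- For every non-trivial linear (projective) automorphism A of ℙ²_ℂ, the normal subgroup of the plane Cremona group generated by A is the whole group: the smallest normal subgroup of Aut_ℂ(ℂ(x,y)) containing A equals Aut_ℂ(ℂ(x,y)). -/

import Mathlib

set_option autoImplicit false

noncomputable section

/-- The field `ℂ(x,y)` of rational functions in two variables over `ℂ`. -/
abbrev K2 : Type := FractionRing (MvPolynomial (Fin 2) ℂ)

/-- The plane Cremona group `Bir(ℙ²_ℂ)`, identified with the group `Aut_ℂ(ℂ(x,y))`
of `ℂ`-algebra automorphisms of `ℂ(x,y)`. -/
abbrev Cremona2 : Type := K2 ≃ₐ[ℂ] K2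

/-- The coordinate function `x`. -/
def X0 : K2 := algebraMap (MvPolynomial (Fin 2) ℂ) K2 (MvPolynomial.X 0)

/-- The coordinate function `y`. -/
def X1 : K2 := algebraMap (MvPolynomial (Fin 2) ℂ) K2 (MvPolynomial.X 1)

/-- The degree-one rational function `a·x + b·y + c` in `ℂ(x,y)`. -/
def lin2 (a b c : ℂ) : K2 :=
  algebraMap ℂ K2 a * X0 + algebraMap ℂ K2 b * X1 + algebraMap ℂ K2 c

/-- `f ∈ Bir(ℙ²_ℂ)` is a linear (projective) automorphism: there is an invertible
`3×3` complex matrix `A = (a_{ij})` with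
`f(x) = (a₀₀x + a₀₁y + a₀₂)/(a₂₀x + a₂₁y + a₂₂)` and
`f(y) = (a₁₀x + a₁₁y + a₁₂)/(a₂₀x + a₂₁y + a₂₂)`. -/
def IsLinearAut (f : Cremona2) : Prop :=
  ∃ A : Matrix (Fin 3) (Fin 3) ℂ, IsUnit A ∧
    f X0 = lin2 (A 0 0) (A 0 1) (A 0 2) / lin2 (A 2 0) (A 2 1) (A 2 2) ∧
    f X1 = lin2 (A 1 0) (A 1 1) (A 1 2) / lin2 (A 2 0) (A 2 1) (A 2 2)

namespace PlaneCremona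

open Polynomial WithZero

section Eval

variable {A : Type*} [CommRing A] [Algebra ℂ A]

/-- Evaluation of a bivariate polynomial at a pair of elements. -/
def ev (a b : A) : ℂ[X][X] →ₐ[ℂ] A := aevalAeval a b

lemma ev_eq_eval₂ (a b : A) (F : ℂ[X][X]) :
    ev a b F = F.eval₂ (aeval a : ℂ[X] →ₐ[ℂ] A).toRingHom b := by
  induction F using Polynomial.induction_on' with
  | add p q hp hq => simp [hp, hq, eval₂_add]
  | monomial n p => simp [ev, ← C_mul_X_pow_eq_monomial]

lemma ev_C (a b : A) (p : ℂ[X]) : ev a b (C p) = aeval a p := by simp [ev]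

lemma ev_X (a b : A) : ev a b X = b := by simp [ev]

lemma ev_map_C (a b : A) (p : ℂ[X]) : ev a b (p.map C) = aeval b p := by
  induction p using Polynomial.induction_on' with
  | add p q hp hq => simp [hp, hq]
  | monomial n p => simp [← C_mul_X_pow_eq_monomial, ev_C, ev_X]

lemma ev_swap (a b : A) (F : ℂ[X][X]) : ev a b (Bivariate.swap F) = ev b a F :=
  Bivariate.aevalAeval_swap a b F

lemma ev_comp (a b : A) (F P : ℂ[X][X]) : ev a b (F.comp P) = ev a (ev a b P) F := by
  simp only [ev_eq_eval₂, eval₂_comp]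

lemma ev_comp_mul (a b : A) (F : ℂ[X][X]) :
    ev a b (F.comp (C X * X)) = ev a (a * b) F := by
  simp [ev_comp, ev_C, ev_X]

lemma ev_taylor (a b : A) (c : ℂ) (F : ℂ[X][X]) :
    ev a b (taylor (C c) F) = ev a (b + algebraMap ℂ A c) F := by
  simp [taylor_apply, ev_comp, ev_C, ev_X]

/-- Translation of the first variable. -/
def taylorX (c : ℂ) (F : ℂ[X][X]) : ℂ[X][X] := F.map (taylorAlgHom c).toRingHom

lemma ev_taylorX (a b : A) (c : ℂ) (F : ℂ[X][X]) :
    ev a b (taylorX c F) = ev (a + algebraMap ℂ A c) b F := by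
  simp only [ev_eq_eval₂, taylorX, eval₂_map]
  congr 1
  ext <;> simp

lemma ev_expand (a b : A) (F : ℂ[X][X]) (n : ℕ) (hn : F.natDegree ≤ n) :
    ev a b F = ∑ j ∈ Finset.range (n + 1), aeval a (F.coeff j) * b ^ j := by
  rw [ev_eq_eval₂, eval₂_eq_sum_range' _ (Nat.lt_succ_of_le hn)]
  rfl

end Eval

/-- The pair `F` has multiplicity at most `m` at the origin. -/
def MultLE (F : ℂ[X][X]) (m : ℕ) : Prop := ∃ i j, i + j ≤ m ∧ (F.coeff j).coeff i ≠ 0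

lemma coeff_swap (F : ℂ[X][X]) (i j : ℕ) :
    ((Bivariate.swap F).coeff j).coeff i = (F.coeff i).coeff j := by
  induction F using Polynomial.induction_on' with
  | add p q hp hq => simp [hp, hq]
  | monomial n p =>
    induction p using Polynomial.induction_on' with
    | add p q hp hq => simp [hp, hq]
    | monomial k c =>
      rw [Bivariate.swap_monomial_monomial]
      simp only [coeff_monomial]
      split_ifs <;> simp_all [coeff_monomial]

lemma MultLE.swap {F : ℂ[X][X]} {m : ℕ} (h : MultLE F m) : MultLE (Bivariate.swap F) m := by
  obtain ⟨i, j, hij, h⟩ := h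
  exact ⟨j, i, by omega, by rwa [coeff_swap]⟩

lemma MultLE.mono {F : ℂ[X][X]} {m n : ℕ} (h : MultLE F m) (hmn : m ≤ n) : MultLE F n := by
  obtain ⟨i, j, hij, h⟩ := h
  exact ⟨i, j, by omega, h⟩

lemma not_multLE {F : ℂ[X][X]} {m : ℕ} (h : ¬ MultLE F m) {i j : ℕ} (hij : i + j ≤ m) :
    (F.coeff j).coeff i = 0 := by
  by_contra hc
  exact h ⟨i, j, hij, hc⟩

/-- If every monomial of `F` has degree at least `m`, then `F(x, xy)` is divisible by `x ^ m`. -/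
lemma exists_blowup {F : ℂ[X][X]} {m : ℕ} (h : ∀ i j, i + j < m → (F.coeff j).coeff i = 0) :
    ∃ F₁ : ℂ[X][X], C (X ^ m) * F₁ = F.comp (C X * X) ∧
      ∀ j, X ^ m * F₁.coeff j = F.coeff j * X ^ j := by
  have hd : C (X ^ m : ℂ[X]) ∣ F.comp (C X * X) := by
    rw [C_dvd_iff_dvd_coeff]
    intro j
    rw [comp_C_mul_X_coeff, X_pow_dvd_iff]
    intro d hd
    rw [coeff_mul_X_pow']
    split_ifs with hj
    · exact h _ _ (by omega)
    · rfl
  obtain ⟨F₁, hF⟩ := hd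
  refine ⟨F₁, hF.symm, fun j => ?_⟩
  rw [← comp_C_mul_X_coeff, hF, coeff_C_mul]

section Local

variable {M : Type*} [Field M] [Algebra ℂ M]

/-- The Jacobian determinant of a pair of elements with respect to a pair of derivations. -/
def jac (D₁ D₂ : Derivation ℂ M M) (a b : M) : M := D₁ a * D₂ b - D₂ a * D₁ b

variable (D₁ D₂ : Derivation ℂ M M)

lemma jac_mul_self (a b : M) : jac D₁ D₂ a (a * b) = a * jac D₁ D₂ a b := by
  simp [jac]; ring

lemma jac_swap (a b : M) : jac D₁ D₂ a b = - jac D₁ D₂ b a := by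
  simp [jac]; ring

lemma jac_sub_right (a b : M) (c : ℂ) : jac D₁ D₂ a (b - algebraMap ℂ M c) = jac D₁ D₂ a b := by
  simp [jac]

lemma jac_sub_left (a b : M) (c : ℂ) : jac D₁ D₂ (a - algebraMap ℂ M c) b = jac D₁ D₂ a b := by
  simp [jac]

/-- A discrete valuation trivial on `ℂ` whose valuation ring is stable under two derivations. -/
structure IsPlace (w : Valuation M ℤᵐ⁰) (D₁ D₂ : Derivation ℂ M M) : Prop where
  const : ∀ c : ℂ, c ≠ 0 → w (algebraMap ℂ M c) = 1
  left : ∀ a, w a ≤ 1 → w (D₁ a) ≤ 1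
  right : ∀ a, w a ≤ 1 → w (D₂ a) ≤ 1

variable {D₁ D₂} {w : Valuation M ℤᵐ⁰}

namespace IsPlace

lemma const_le (hw : IsPlace w D₁ D₂) (c : ℂ) : w (algebraMap ℂ M c) ≤ 1 := by
  by_cases hc : c = 0
  · simp [hc]
  · exact (hw.const c hc).le

lemma jac_le (hw : IsPlace w D₁ D₂) {a b : M} (ha : w a ≤ 1) (hb : w b ≤ 1) :
    w (jac D₁ D₂ a b) ≤ 1 := by
  refine (w.map_sub _ _).trans (max_le ?_ ?_) <;> rw [map_mul]
  · exact mul_le_one' (hw.left a ha) (hw.right b hb)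
  · exact mul_le_one' (hw.right a ha) (hw.left b hb)

lemma aeval_le (hw : IsPlace w D₁ D₂) {a : M} (ha : w a ≤ 1) (p : ℂ[X]) : w (aeval a p) ≤ 1 := by
  rw [aeval_eq_sum_range]
  refine w.map_sum_le fun i _ => ?_
  rw [Algebra.smul_def, map_mul, map_pow]
  exact mul_le_one' (hw.const_le _) (pow_le_one' ha _)

lemma ev_le (hw : IsPlace w D₁ D₂) {a b : M} (ha : w a ≤ 1) (hb : w b ≤ 1) (F : ℂ[X][X]) :
    w (ev a b F) ≤ 1 := by
  rw [ev_expand a b F _ le_rfl]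
  refine w.map_sum_le fun i _ => ?_
  rw [map_mul, map_pow]
  exact mul_le_one' (hw.aeval_le ha _) (pow_le_one' hb _)

/-- If a nonzero polynomial vanishes at the residue of `b`, this residue is a constant. -/
lemma exists_const (hw : IsPlace w D₁ D₂) {b : M} {p : ℂ[X]} (hp : p ≠ 0)
    (h : w (aeval b p) < 1) : ∃ c : ℂ, w (b - algebraMap ℂ M c) < 1 := by
  by_contra! hc
  refine absurd h (not_lt.mpr ?_)
  rw [(IsAlgClosed.splits p).eq_prod_roots, map_mul, map_mul, aeval_C,
    hw.const _ (leadingCoeff_ne_zero.mpr hp), one_mul, map_multiset_prod, map_multiset_prod,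
    Multiset.map_map, Multiset.map_map]
  refine Multiset.one_le_prod_of_one_le ?_
  intro x hx
  obtain ⟨c, -, rfl⟩ := Multiset.mem_map.mp hx
  simpa using hc c

/-- The specialisation of `F` at `x = 0`. -/
lemma ev_congr_of_lt (hw : IsPlace w D₁ D₂) {a b : M} (ha : w a < 1) (hb : w b ≤ 1)
    (F : ℂ[X][X]) : w (ev a b F - aeval b (F.map (evalRingHom 0))) < 1 := by
  have key : ∃ H : ℂ[X][X], F = C X * H + (F.map (evalRingHom 0)).map C := by
    have : C X ∣ F - (F.map (evalRingHom 0)).map C := by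
      rw [C_dvd_iff_dvd_coeff]
      intro i
      rw [X_dvd_iff]
      simp [coeff_zero_eq_eval_zero]
    obtain ⟨H, hH⟩ := this
    exact ⟨H, by rw [← hH]; ring⟩
  obtain ⟨H, hH⟩ := key
  have h2 : ev a b F - aeval b (F.map (evalRingHom 0)) = a * ev a b H := by
    conv_lhs => lhs; rw [hH]
    rw [map_add, map_mul, ev_C, ev_map_C]; simp
  rw [h2, map_mul]
  exact mul_lt_one_of_lt_of_le ha (hw.ev_le ha.le hb H)

lemma jac_pow_le_aux (hw : IsPlace w D₁ D₂) (k : ℕ) : ∀ (a b : M) (F : ℂ[X][X]) (m : ℕ),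
    w a < 1 → w b < 1 → MultLE F m → exp (-(k : ℤ)) ≤ w (jac D₁ D₂ a b) →
    w (jac D₁ D₂ a b) ^ m ≤ w (ev a b F) := by
  induction k with
  | zero =>
    have key : ∀ a b : M, w a < 1 → w b < 1 → w b ≤ w a → w (jac D₁ D₂ a b) < 1 := by
      intro a b ha hb hba
      rcases eq_or_ne a 0 with rfl | h0
      · simp [jac]
      obtain ⟨b₁, rfl⟩ : ∃ b₁, b = a * b₁ := ⟨b / a, by field_simp⟩
      have hb₁ : w b₁ ≤ 1 := by
        rw [map_mul] at hba
        exact (mul_le_iff_le_one_right (zero_lt_iff.mpr ((w.ne_zero_iff).mpr h0))).mp hba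
      rw [jac_mul_self, map_mul]
      exact mul_lt_one_of_lt_of_le ha (hw.jac_le ha.le hb₁)
    intro a b F m ha hb hF hk
    exfalso
    have h1 : (1 : ℤᵐ⁰) ≤ w (jac D₁ D₂ a b) := by simpa using hk
    rcases le_total (w b) (w a) with h | h
    · exact absurd (key a b ha hb h) (not_lt.mpr h1)
    · rw [jac_swap, Valuation.map_neg] at h1
      exact absurd (key b a hb ha h) (not_lt.mpr h1)
  | succ k ih =>
    have key : ∀ (a b : M) (F : ℂ[X][X]) (m : ℕ), w a < 1 → w b < 1 → w b ≤ w a → MultLE F m →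
        exp (-((k + 1 : ℕ) : ℤ)) ≤ w (jac D₁ D₂ a b) → w (jac D₁ D₂ a b) ^ m ≤ w (ev a b F) := by
      intro a b F m ha hb hba hF hk
      rcases eq_or_ne a 0 with rfl | h0
      · simp [jac] at hk
      have hwa : 0 < w a := zero_lt_iff.mpr ((w.ne_zero_iff).mpr h0)
      obtain ⟨b₁, rfl⟩ : ∃ b₁, b = a * b₁ := ⟨b / a, by field_simp⟩
      have hb₁ : w b₁ ≤ 1 := by
        rw [map_mul] at hba
        exact (mul_le_iff_le_one_right hwa).mp hba
      have hJ₁ := hw.jac_le ha.le hb₁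
      classical
      have hex : ∃ m, MultLE F m := ⟨m, hF⟩
      set μ := Nat.find hex with hμ
      have hμF : MultLE F μ := Nat.find_spec hex
      have hμm : μ ≤ m := Nat.find_min' hex hF
      obtain ⟨F₁, hF₁, hc₁⟩ := exists_blowup (F := F) (m := μ) (fun i j hij => by
        have := Nat.find_min hex hij
        exact not_multLE this le_rfl)
      have hev : ev a (a * b₁) F = a ^ μ * ev a b₁ F₁ := by
        rw [← ev_comp_mul, ← hF₁, map_mul, ev_C]; simp
      set q : ℂ[X] := F₁.map (evalRingHom 0) with hq
      have hqc : ∀ j, q.coeff j = (F₁.coeff j).coeff 0 := fun j => by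
        simp [hq, coeff_zero_eq_eval_zero]
      have hq0 : q ≠ 0 := by
        obtain ⟨i, j, hij, h⟩ := hμF
        have hij' : i + j = μ := le_antisymm hij (Nat.find_min' hex ⟨i, j, le_rfl, h⟩)
        intro h0
        have h1 := congrArg (coeff · μ) (hc₁ j)
        have h2 : (X ^ μ * F₁.coeff j).coeff μ = (F₁.coeff j).coeff 0 := by
          simpa using coeff_X_pow_mul (F₁.coeff j) μ 0
        have h3 : (F.coeff j * X ^ j).coeff μ = (F.coeff j).coeff i := by
          rw [← hij', coeff_mul_X_pow]
        simp only [h2, h3, ← hqc, h0] at h1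
        exact h h1.symm
      have hqd : q.natDegree ≤ μ := by
        rw [natDegree_le_iff_coeff_eq_zero]
        intro j hj
        rw [hqc]
        have h1 := congrArg (coeff · μ) (hc₁ j)
        have h2 : (X ^ μ * F₁.coeff j).coeff μ = (F₁.coeff j).coeff 0 := by
          simpa using coeff_X_pow_mul (F₁.coeff j) μ 0
        have h3 : (F.coeff j * X ^ j).coeff μ = 0 := by
          rw [coeff_mul_X_pow', if_neg (by omega)]
        simp only [h2, h3] at h1
        exact h1
      have hev₁ : w (jac D₁ D₂ a b₁) ^ μ ≤ w (ev a b₁ F₁) := by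
        by_cases hc : ∃ c : ℂ, w (b₁ - algebraMap ℂ M c) < 1
        · obtain ⟨c, hc⟩ := hc
          have h1 := ih a (b₁ - algebraMap ℂ M c) (taylor (C c) F₁) μ ha hc (by
            have hne : taylor c q ≠ 0 := by rwa [Ne, taylor_eq_zero]
            refine ⟨0, (taylor c q).natDegree, by rw [natDegree_taylor]; omega, ?_⟩
            have : ((taylor (C c) F₁).coeff (taylor c q).natDegree).coeff 0 =
                (taylor c q).leadingCoeff := by
              rw [leadingCoeff, coeff_zero_eq_eval_zero, hq, ← coe_evalRingHom, ← coeff_map,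
                map_taylor]
              simp
            rw [this]
            exact leadingCoeff_ne_zero.mpr hne) (by
            rw [jac_sub_right]
            rw [jac_mul_self, map_mul] at hk
            have hJ0 : w (jac D₁ D₂ a b₁) ≠ 0 := by
              intro h
              simp [h] at hk
            rw [← exp_log hJ0, ← exp_log hwa.ne', ← exp_add, exp_le_exp] at hk
            rw [← exp_log hwa.ne', ← exp_zero, exp_lt_exp] at ha
            rw [← exp_log hJ0, exp_le_exp]
            push_cast at hk
            omega)
          rw [jac_sub_right, ev_taylor, sub_add_cancel] at h1
          exact h1
        · have h1 : w (ev a b₁ F₁) = 1 := by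
            have h2 : w (aeval b₁ q) = 1 := by
              refine le_antisymm (hw.aeval_le hb₁ q) (not_lt.mp fun h => hc ?_)
              exact hw.exists_const hq0 h
            have h3 := hw.ev_congr_of_lt ha hb₁ F₁
            rw [← h2, ← hq] at h3
            rw [← h2]
            exact Valuation.map_eq_of_sub_lt w h3
          rw [h1]
          exact pow_le_one' hJ₁ _
      rw [hev, jac_mul_self, map_mul, map_mul, map_pow]
      calc (w a * w (jac D₁ D₂ a b₁)) ^ m ≤ (w a * w (jac D₁ D₂ a b₁)) ^ μ :=
            pow_le_pow_right_of_le_one' (mul_le_one' ha.le hJ₁) hμm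
        _ = w a ^ μ * w (jac D₁ D₂ a b₁) ^ μ := mul_pow _ _ _
        _ ≤ _ := mul_le_mul_right hev₁ _
    intro a b F m ha hb hF hk
    rcases le_total (w b) (w a) with h | h
    · exact key a b F m ha hb h hF hk
    · rw [jac_swap, Valuation.map_neg] at hk ⊢
      rw [← ev_swap]
      exact key b a _ m hb ha h hF.swap hk

/-- At a point of multiplicity at most `m`, the order of vanishing of `F` is at most `m` times the
order of vanishing of the Jacobian determinant. -/
theorem jac_pow_le (hw : IsPlace w D₁ D₂) {a b : M} {F : ℂ[X][X]} {m : ℕ} (ha : w a < 1)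
    (hb : w b < 1) (hJ : jac D₁ D₂ a b ≠ 0) (hF : MultLE F m) :
    w (jac D₁ D₂ a b) ^ m ≤ w (ev a b F) := by
  obtain ⟨k, hk⟩ : ∃ k : ℕ, exp (-(k : ℤ)) ≤ w (jac D₁ D₂ a b) := by
    have h0 : w (jac D₁ D₂ a b) ≠ 0 := (w.ne_zero_iff).mpr hJ
    refine ⟨(-(log (w (jac D₁ D₂ a b)))).toNat, ?_⟩
    rw [← exp_log h0, exp_le_exp, log_exp]
    omega
  exact jac_pow_le_aux hw k a b F m ha hb hF hk

end IsPlace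

end Local

end PlaneCremona

namespace PlaneCremona

open Polynomial WithZero

/-- Relatively prime bivariate polynomials generate an ideal meeting `ℂ[x]`. -/
lemma exists_bezout {F G : ℂ[X][X]} (h : IsRelPrime F G) :
    ∃ (r : ℂ[X]) (S T : ℂ[X][X]), r ≠ 0 ∧ S * F + T * G = C r := by
  classical
  let : NormalizedGCDMonoid ℂ[X] := Nonempty.some inferInstance
  set φ := algebraMap ℂ[X] (RatFunc ℂ) with hφ
  have hφi : Function.Injective φ := IsFractionRing.injective _ _
  have hcop : IsCoprime (F.map φ) (G.map φ) := by
    rw [← EuclideanDomain.gcd_isUnit_iff]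
    set g := EuclideanDomain.gcd (F.map φ) (G.map φ) with hg
    have hgF : g ∣ F.map φ := EuclideanDomain.gcd_dvd_left _ _
    have hgG : g ∣ G.map φ := EuclideanDomain.gcd_dvd_right _ _
    have hg0 : g ≠ 0 := by
      intro h0
      obtain ⟨hF, hG⟩ := EuclideanDomain.gcd_eq_zero_iff.mp h0
      rw [Polynomial.map_eq_zero_iff hφi] at hF hG
      subst hF hG
      exact not_isUnit_zero (isRelPrime_zero_left.mp h)
    refine isUnit_or_eq_zero_of_isUnit_integerNormalization_primPart (R := ℂ[X]) hg0 ?_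
    set P := (IsLocalization.integerNormalization (nonZeroDivisors ℂ[X]) g).primPart with hP
    obtain ⟨b, hb0, hb⟩ := IsLocalization.integerNormalization_spec (nonZeroDivisors ℂ[X]) g
    have hbφ : IsUnit (C (φ b) : (RatFunc ℂ)[X]) := by
      rw [Polynomial.isUnit_C, isUnit_iff_ne_zero, Ne, map_eq_zero_iff φ hφi]
      exact nonZeroDivisors.ne_zero hb0
    have hdvd : P.map φ ∣ g := by
      have h1 : P.map φ ∣ (IsLocalization.integerNormalization (nonZeroDivisors ℂ[X]) g).map φ :=
        Polynomial.map_dvd φ (primPart_dvd _)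
      rw [hb] at h1
      rw [Algebra.smul_def, show algebraMap ℂ[X] (RatFunc ℂ)[X] b = C (φ b) from rfl] at h1
      exact (hbφ.dvd_mul_left).mp h1
    have hprim : P.IsPrimitive := isPrimitive_primPart _
    exact h (hprim.dvd_of_fraction_map_dvd_fraction_map (hdvd.trans hgF))
      (hprim.dvd_of_fraction_map_dvd_fraction_map (hdvd.trans hgG))
  obtain ⟨A, B, hAB⟩ := hcop
  obtain ⟨c, hc0, hc⟩ := IsLocalization.integerNormalization_spec (nonZeroDivisors ℂ[X]) A
  obtain ⟨d, hd0, hd⟩ := IsLocalization.integerNormalization_spec (nonZeroDivisors ℂ[X]) B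
  refine ⟨c * d, C d * IsLocalization.integerNormalization (nonZeroDivisors ℂ[X]) A,
    C c * IsLocalization.integerNormalization (nonZeroDivisors ℂ[X]) B,
    mul_ne_zero (nonZeroDivisors.ne_zero hc0) (nonZeroDivisors.ne_zero hd0), ?_⟩
  apply Polynomial.map_injective φ hφi
  rw [Algebra.smul_def, show algebraMap ℂ[X] (RatFunc ℂ)[X] c = C (φ c) from rfl, ← hφ] at hc
  rw [Algebra.smul_def, show algebraMap ℂ[X] (RatFunc ℂ)[X] d = C (φ d) from rfl, ← hφ] at hd
  simp only [Polynomial.map_add, Polynomial.map_mul, map_C, hc, hd, map_mul]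
  linear_combination (C (φ c) * C (φ d)) * hAB

/-- Translation by a vector. -/
def translate (c₁ c₂ : ℂ) : ℂ[X][X] →+* ℂ[X][X] :=
  (taylorAlgHom (C c₂)).toRingHom.comp (mapRingHom (taylorAlgHom c₁).toRingHom)

lemma translate_apply (c₁ c₂ : ℂ) (F : ℂ[X][X]) :
    translate c₁ c₂ F = taylor (C c₂) (taylorX c₁ F) := rfl

/-- One of `F` and `G` has multiplicity at most `m` at the point `(c₁, c₂)`. -/
def PairMultLE (F G : ℂ[X][X]) (m : ℕ) (c₁ c₂ : ℂ) : Prop :=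
  MultLE (translate c₁ c₂ F) m ∨ MultLE (translate c₁ c₂ G) m

section

variable {M : Type*} [Field M] [Algebra ℂ M] {D₁ D₂ : Derivation ℂ M M} {w : Valuation M ℤᵐ⁰}

lemma ev_translate (a b : M) (c₁ c₂ : ℂ) (F : ℂ[X][X]) :
    ev (a - algebraMap ℂ M c₁) (b - algebraMap ℂ M c₂) (translate c₁ c₂ F) = ev a b F := by
  rw [translate_apply, ev_taylor, ev_taylorX, sub_add_cancel, sub_add_cancel]

lemma IsPlace.chart (hw : IsPlace w D₁ D₂) {u a b : M} {F G : ℂ[X][X]} {m : ℕ} (hu : w u = 1)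
    (ha : w a ≤ 1) (hb : w b ≤ 1) (hJ : jac D₁ D₂ a b ≠ 0) (hFG : ev a b F = u * ev a b G)
    (hcop : w (ev a b F) < 1 → w (ev a b G) < 1 →
      ∃ c₁ c₂ : ℂ, w (a - algebraMap ℂ M c₁) < 1 ∧ w (b - algebraMap ℂ M c₂) < 1)
    (hm : ∀ c₁ c₂ : ℂ, w (a - algebraMap ℂ M c₁) < 1 → w (b - algebraMap ℂ M c₂) < 1 →
      PairMultLE F G m c₁ c₂) :
    w (jac D₁ D₂ a b) ^ m ≤ w (ev a b G) := by
  have hFw : w (ev a b F) = w (ev a b G) := by rw [hFG, map_mul, hu, one_mul]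
  by_cases hG : w (ev a b G) < 1
  · obtain ⟨c₁, c₂, h₁, h₂⟩ := hcop (hFw ▸ hG) hG
    have hJ' : jac D₁ D₂ (a - algebraMap ℂ M c₁) (b - algebraMap ℂ M c₂) = jac D₁ D₂ a b := by
      rw [jac_sub_left, jac_sub_right]
    rcases hm c₁ c₂ h₁ h₂ with h | h
    · have := hw.jac_pow_le h₁ h₂ (hJ'.symm ▸ hJ) h
      rwa [hJ', ev_translate, hFw] at this
    · have := hw.jac_pow_le h₁ h₂ (hJ'.symm ▸ hJ) h
      rwa [hJ', ev_translate] at this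
  · exact (pow_le_one' (hw.jac_le ha hb) m).trans (not_lt.mp hG)

lemma IsPlace.exists_const_left (hw : IsPlace w D₁ D₂) {a b : M} {F G : ℂ[X][X]}
    (ha : w a ≤ 1) (hb : w b ≤ 1) (hrel : IsRelPrime F G)
    (hF : w (ev a b F) < 1) (hG : w (ev a b G) < 1) : ∃ c : ℂ, w (a - algebraMap ℂ M c) < 1 := by
  obtain ⟨r, S, T, hr, h⟩ := exists_bezout hrel
  refine hw.exists_const hr ?_
  rw [← ev_C a b, ← h, map_add, map_mul, map_mul]
  refine (w.map_add _ _).trans_lt (max_lt ?_ ?_) <;> rw [map_mul]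
  · rw [mul_comm]; exact mul_lt_one_of_lt_of_le hF (hw.ev_le ha hb S)
  · rw [mul_comm]; exact mul_lt_one_of_lt_of_le hG (hw.ev_le ha hb T)

lemma isRelPrime_swap {F G : ℂ[X][X]} (h : IsRelPrime F G) :
    IsRelPrime (Bivariate.swap F) (Bivariate.swap G) := by
  intro d hdF hdG
  have h1 := map_dvd (Bivariate.swap (R := ℂ)) hdF
  have h2 := map_dvd (Bivariate.swap (R := ℂ)) hdG
  rw [Bivariate.swap_swap_apply] at h1 h2
  have := (h h1 h2).map (Bivariate.swap (R := ℂ))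
  rwa [Bivariate.swap_swap_apply] at this

/-- At a place where relatively prime polynomials vanish simultaneously, the residues are
constants. -/
lemma IsPlace.exists_const_of_isRelPrime (hw : IsPlace w D₁ D₂) {a b : M} {F G : ℂ[X][X]}
    (ha : w a ≤ 1) (hb : w b ≤ 1) (hrel : IsRelPrime F G)
    (hF : w (ev a b F) < 1) (hG : w (ev a b G) < 1) :
    ∃ c₁ c₂ : ℂ, w (a - algebraMap ℂ M c₁) < 1 ∧ w (b - algebraMap ℂ M c₂) < 1 := by
  obtain ⟨c₁, h₁⟩ := hw.exists_const_left ha hb hrel hF hG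
  obtain ⟨c₂, h₂⟩ := hw.exists_const_left (a := b) (b := a) hb ha (isRelPrime_swap hrel)
    (by rwa [ev_swap]) (by rwa [ev_swap])
  exact ⟨c₁, c₂, h₁, h₂⟩

lemma IsPlace.exists_const_of_lt (hw : IsPlace w D₁ D₂) {a b : M} {F G : ℂ[X][X]}
    (ha : w a < 1) (hb : w b ≤ 1)
    (hne : F.map (evalRingHom 0) ≠ 0 ∨ G.map (evalRingHom 0) ≠ 0)
    (hF : w (ev a b F) < 1) (hG : w (ev a b G) < 1) :
    ∃ c₁ c₂ : ℂ, w (a - algebraMap ℂ M c₁) < 1 ∧ w (b - algebraMap ℂ M c₂) < 1 := by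
  have key : ∀ H : ℂ[X][X], H.map (evalRingHom 0) ≠ 0 → w (ev a b H) < 1 →
      ∃ c : ℂ, w (b - algebraMap ℂ M c) < 1 := by
    intro H hH h
    refine hw.exists_const hH ?_
    rw [← sub_sub_cancel (ev a b H) (aeval b (H.map (evalRingHom 0)))]
    exact (w.map_sub _ _).trans_lt (max_lt h (hw.ev_congr_of_lt ha hb H))
  obtain ⟨c, hc⟩ : ∃ c : ℂ, w (b - algebraMap ℂ M c) < 1 := by
    rcases hne with h | h
    · exact key F h hF
    · exact key G h hG
  exact ⟨0, c, by simpa using ha, hc⟩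

lemma IsPlace.const_eq_zero (hw : IsPlace w D₁ D₂) {b : M} (hb : w b < 1) {c : ℂ}
    (hc : w (b - algebraMap ℂ M c) < 1) : c = 0 := by
  by_contra h
  have h1 := hw.const c h
  rw [← sub_sub_cancel b (algebraMap ℂ M c)] at h1
  exact absurd h1 ((w.map_sub _ _).trans_lt (max_lt hb hc)).ne

end

end PlaneCremona

namespace PlaneCremona

open Polynomial WithZero

/-- A derivation of a domain extends to its fraction field. -/
lemma exists_derivation_extension {R L : Type*} [CommRing R] [IsDomain R] [Field L] [Algebra R L]
    [IsFractionRing R L] [Algebra ℂ R] [Algebra ℂ L] [IsScalarTower ℂ R L]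
    (d : Derivation ℂ R R) :
    ∃ D : Derivation ℂ L L, ∀ r, D (algebraMap R L r) = algebraMap R L (d r) := by
  let φ : R →+* DualNumber L :=
    { toFun := fun r => TrivSqZeroExt.inl (algebraMap R L r) +
        TrivSqZeroExt.inr (algebraMap R L (d r))
      map_one' := by simp
      map_zero' := by simp
      map_add' := fun x y => by ext <;> simp [Algebra.smul_def]
      map_mul' := fun x y => by
        ext
        · simp
        · simp
          simp only [Algebra.smul_def]
          ring }
  have hφ1 : ∀ r, (φ r).fst = algebraMap R L r := fun r => by simp [φ]
  have hφ2 : ∀ r, (φ r).snd = algebraMap R L (d r) := fun r => by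
    simp [φ]
    rw [Algebra.smul_def, mul_one]
  have hu : ∀ y : nonZeroDivisors R, IsUnit (φ y) := by
    intro y
    rw [TrivSqZeroExt.isUnit_iff_isUnit_fst, hφ1, isUnit_iff_ne_zero]
    exact IsFractionRing.to_map_ne_zero_of_mem_nonZeroDivisors y.2
  let ψ : L →+* DualNumber L := IsLocalization.lift (M := nonZeroDivisors R) hu
  have hψ : ∀ r, ψ (algebraMap R L r) = φ r := fun r => IsLocalization.lift_eq hu r
  have hψ1 : ∀ x, (ψ x).fst = x := by
    intro x
    have : ((TrivSqZeroExt.fstHom L L L).toRingHom.comp ψ) = RingHom.id L := by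
      refine IsLocalization.ringHom_ext (nonZeroDivisors R) (RingHom.ext fun r => ?_)
      change (ψ (algebraMap R L r)).fst = algebraMap R L r
      rw [hψ, hφ1]
    exact congrArg (fun f => f x) this
  have hψc : ∀ c : ℂ, (ψ (algebraMap ℂ L c)).snd = 0 := by
    intro c
    rw [IsScalarTower.algebraMap_apply ℂ R L, hψ, hφ2]
    simp
  let D : L →ₗ[ℂ] L :=
    { toFun := fun x => (ψ x).snd
      map_add' := fun x y => by simp
      map_smul' := fun c x => by
        rw [Algebra.smul_def, map_mul, DualNumber.snd_mul, hψ1, hψc]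
        simp [Algebra.smul_def] }
  refine ⟨Derivation.mk' D fun x y => ?_, fun r => ?_⟩
  · change (ψ (x * y)).snd = x • (ψ y).snd + y • (ψ x).snd
    rw [map_mul, DualNumber.snd_mul, hψ1, hψ1, smul_eq_mul, smul_eq_mul]
    ring
  · change (ψ (algebraMap R L r)).snd = _
    rw [hψ, hφ2]

/-- The field `ℂ(u)(v)`. -/
abbrev RR : Type := RatFunc (RatFunc ℂ)

lemma exists_derivations : ∃ (d₁ d₂ : Derivation ℂ (RatFunc ℂ)[X] (RatFunc ℂ)[X])
    (D₁ D₂ : Derivation ℂ RR RR),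
    (∀ p, D₁ (algebraMap _ RR p) = algebraMap _ RR (d₁ p)) ∧
    (∀ p, D₂ (algebraMap _ RR p) = algebraMap _ RR (d₂ p)) ∧
    (∀ p i, (p.coeff i = 0 → (d₁ p).coeff i = 0)) ∧ (∀ p, d₂ p = derivative p) ∧
    d₁ X = 0 ∧ d₁ (C RatFunc.X) = 1 := by
  obtain ⟨δ, hδ⟩ := exists_derivation_extension (L := RatFunc ℂ) (derivative' (R := ℂ))
  let d₁ : Derivation ℂ (RatFunc ℂ)[X] (RatFunc ℂ)[X] :=
    PolynomialModule.equivPolynomialSelf.compDer δ.mapCoeffs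
  let d₂ : Derivation ℂ (RatFunc ℂ)[X] (RatFunc ℂ)[X] :=
    (derivative' (R := RatFunc ℂ)).restrictScalars ℂ
  obtain ⟨D₁, hD₁⟩ := exists_derivation_extension (L := RR) d₁
  obtain ⟨D₂, hD₂⟩ := exists_derivation_extension (L := RR) d₂
  have hc : ∀ p i, (d₁ p).coeff i = δ (p.coeff i) := fun p i => rfl
  refine ⟨d₁, d₂, D₁, D₂, hD₁, hD₂, fun p i h => ?_, fun p => rfl, ?_, ?_⟩
  · rw [hc, h, map_zero]
  · ext i
    rw [hc, coeff_X]
    split_ifs <;> simp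
  · ext i
    rw [hc, coeff_C, coeff_one]
    have : δ RatFunc.X = 1 := by
      have := hδ X
      rw [RatFunc.algebraMap_X] at this
      rw [this]
      simp
    split_ifs <;> simp_all

lemma derivation_eq_zero {M : Type*} [Field M] [Algebra ℂ M] {a b : M}
    (hab : IntermediateField.adjoin ℂ {a, b} = ⊤) (D : Derivation ℂ M M) (ha : D a = 0)
    (hb : D b = 0) : D = 0 := by
  ext x
  have hx : x ∈ IntermediateField.adjoin ℂ {a, b} := hab ▸ IntermediateField.mem_top
  induction hx using IntermediateField.adjoin_induction with
  | mem x hx => rcases hx with rfl | rfl <;> simp [*]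
  | algebraMap c => simp
  | add x y _ _ hx hy => simp_all
  | inv x _ hx => simp_all [Derivation.leibniz_inv]
  | mul x y _ _ hx hy => simp_all

lemma jac_ne_zero {M : Type*} [Field M] [Algebra ℂ M] {a b u v : M} {D₁ D₂ : Derivation ℂ M M}
    (hab : IntermediateField.adjoin ℂ {a, b} = ⊤) (h₁u : D₁ u = 1)
    (h₁v : D₁ v = 0) (h₂v : D₂ v = 1) : jac D₁ D₂ a b ≠ 0 := by
  intro hJ
  have key : ∀ x y : M, IntermediateField.adjoin ℂ {x, y} = ⊤ → jac D₁ D₂ x y = 0 →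
      D₁ x = 0 := by
    intro x y hxy h
    have h0 := derivation_eq_zero hxy (D₁ x • D₂ - D₂ x • D₁) (by simp [mul_comm])
      (by simpa [jac] using h)
    have := congrArg (fun D => D v) h0
    simpa [h₁v, h₂v] using this
  have ha := key a b hab hJ
  have hb := key b a (by rwa [Set.pair_comm]) (by rw [jac_swap, hJ, neg_zero])
  have := derivation_eq_zero hab D₁ ha hb
  rw [this] at h₁u
  simp at h₁u

lemma isPlace_finite (v : IsDedekindDomain.HeightOneSpectrum (RatFunc ℂ)[X])
    {D₁ D₂ : Derivation ℂ RR RR} {d₁ d₂ : Derivation ℂ (RatFunc ℂ)[X] (RatFunc ℂ)[X]}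
    (h₁ : ∀ p, D₁ (algebraMap _ RR p) = algebraMap _ RR (d₁ p))
    (h₂ : ∀ p, D₂ (algebraMap _ RR p) = algebraMap _ RR (d₂ p)) :
    IsPlace (v.valuation RR) D₁ D₂ ∧
      ∀ c : RatFunc ℂ, c ≠ 0 → v.valuation RR (algebraMap (RatFunc ℂ)[X] RR (C c)) = 1 := by
  have hc : ∀ c : RatFunc ℂ, c ≠ 0 →
      v.valuation RR (algebraMap (RatFunc ℂ)[X] RR (C c)) = 1 := by
    intro c hc
    rw [IsDedekindDomain.HeightOneSpectrum.valuation_eq_one_iff_notMem]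
    intro hmem
    refine v.isPrime.ne_top (Ideal.eq_top_of_isUnit_mem _ hmem ?_)
    exact (isUnit_C.mpr hc.isUnit)
  have key : ∀ (D : Derivation ℂ RR RR) (d : Derivation ℂ (RatFunc ℂ)[X] (RatFunc ℂ)[X]),
      (∀ p, D (algebraMap _ RR p) = algebraMap _ RR (d p)) → ∀ a, v.valuation RR a ≤ 1 →
      v.valuation RR (D a) ≤ 1 := by
    intro D d h a ha
    obtain ⟨n, ⟨s, hs⟩, hns⟩ := v.exists_primeCompl_mul_eq_of_integer (K := RR) a ha
    have hs1 : v.valuation RR (algebraMap _ RR s) = 1 := by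
      rw [IsDedekindDomain.HeightOneSpectrum.valuation_eq_one_iff_notMem]
      exact hs
    have h1 := congrArg D hns
    rw [Derivation.leibniz, h, h, smul_eq_mul, smul_eq_mul] at h1
    have h2 : algebraMap _ RR s * D a = algebraMap _ RR (d n) - a * algebraMap _ RR (d s) := by
      rw [← h1]; ring
    have h3 : v.valuation RR (D a) = v.valuation RR (algebraMap _ RR s * D a) := by
      rw [map_mul, hs1, one_mul]
    rw [h3, h2]
    refine (Valuation.map_sub _ _ _).trans (max_le (v.valuation_le_one _) ?_)
    rw [map_mul]
    exact mul_le_one' ha (v.valuation_le_one _)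
  refine ⟨⟨fun c hc' => ?_, key D₁ d₁ h₁, key D₂ d₂ h₂⟩, hc⟩
  have := hc (algebraMap ℂ (RatFunc ℂ) c) (by simpa using hc')
  rwa [show (C (algebraMap ℂ (RatFunc ℂ) c)) = algebraMap ℂ (RatFunc ℂ)[X] c from rfl,
    ← IsScalarTower.algebraMap_apply] at this

open Classical in
lemma inftyValuation_algebraMap {p : (RatFunc ℂ)[X]} (hp : p ≠ 0) :
    RatFunc.inftyValuation (RatFunc ℂ) (algebraMap _ RR p) = exp (p.natDegree : ℤ) :=
  RatFunc.inftyValuation.polynomial _ hp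

open Classical in
lemma inftyValuation_polynomial_le {p : (RatFunc ℂ)[X]} {n : ℕ} (h : p.natDegree ≤ n) :
    RatFunc.inftyValuation (RatFunc ℂ) (algebraMap _ RR p) ≤ exp (n : ℤ) := by
  rcases eq_or_ne p 0 with rfl | hp
  · simp
  · rw [inftyValuation_algebraMap hp]
    simpa using h

open Classical in
lemma isPlace_infty {D₁ D₂ : Derivation ℂ RR RR}
    {d₁ d₂ : Derivation ℂ (RatFunc ℂ)[X] (RatFunc ℂ)[X]}
    (h₁ : ∀ p, D₁ (algebraMap _ RR p) = algebraMap _ RR (d₁ p))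
    (h₂ : ∀ p, D₂ (algebraMap _ RR p) = algebraMap _ RR (d₂ p))
    (hd₁ : ∀ p i, (p.coeff i = 0 → (d₁ p).coeff i = 0)) (hd₂ : ∀ p, d₂ p = derivative p) :
    IsPlace (RatFunc.inftyValuation (RatFunc ℂ)) D₁ ((RatFunc.X : RR) ^ 2 • D₂) := by
  set w := RatFunc.inftyValuation (RatFunc ℂ) with hw
  have hdeg : ∀ p : (RatFunc ℂ)[X], (d₁ p).natDegree ≤ p.natDegree := by
    intro p
    rw [natDegree_le_iff_coeff_eq_zero]
    intro i hi
    exact hd₁ p i (coeff_eq_zero_of_natDegree_lt hi)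
  have hfrac : ∀ a : RR, w a ≤ 1 → ∃ p q : (RatFunc ℂ)[X], q ≠ 0 ∧ p.natDegree ≤ q.natDegree ∧
      algebraMap _ RR q ≠ 0 ∧ w (algebraMap _ RR q) = exp (q.natDegree : ℤ) ∧
      a = algebraMap _ RR p / algebraMap _ RR q := by
    intro a ha
    have hq := RatFunc.denom_ne_zero a
    have hq' : algebraMap _ RR (RatFunc.denom a) ≠ 0 := by
      simpa using hq
    have hwq := inftyValuation_algebraMap hq
    refine ⟨a.num, a.denom, hq, ?_, hq', hwq, (RatFunc.num_div_denom a).symm⟩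
    rcases eq_or_ne a.num 0 with h0 | h0
    · simp [h0]
    · have hwp := inftyValuation_algebraMap h0
      rw [← RatFunc.num_div_denom a, map_div₀, hwp, hwq, ← exp_sub, ← exp_zero, exp_le_exp] at ha
      omega
  have hquot : ∀ (D : Derivation ℂ RR RR) (p q : (RatFunc ℂ)[X])
      (d : Derivation ℂ (RatFunc ℂ)[X] (RatFunc ℂ)[X]),
      (∀ p, D (algebraMap _ RR p) = algebraMap _ RR (d p)) → algebraMap _ RR q ≠ 0 →
      D (algebraMap _ RR p / algebraMap _ RR q) =
        algebraMap _ RR (q * d p - p * d q) / algebraMap _ RR q ^ 2 := by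
    intro D p q d h hq
    rw [Derivation.leibniz_div, h, h]
    simp only [smul_eq_mul, map_sub, map_mul]
    field_simp
  refine ⟨fun c hc => ?_, fun a ha => ?_, fun a ha => ?_⟩
  · rw [IsScalarTower.algebraMap_apply ℂ (RatFunc ℂ) RR]
    exact RatFunc.inftyValuation.C (RatFunc ℂ) (by simpa using hc)
  · obtain ⟨p, q, hq0, hpq, hq, hwq, rfl⟩ := hfrac a ha
    rw [hquot D₁ p q d₁ h₁ hq, map_div₀, map_pow, hwq, ← exp_nsmul]
    have : (q * d₁ p - p * d₁ q).natDegree ≤ q.natDegree + q.natDegree := by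
      have h1 := hdeg p
      have h2 := hdeg q
      refine (natDegree_sub_le _ _).trans (max_le ?_ ?_) <;>
      refine natDegree_mul_le.trans ?_ <;> omega
    refine div_le_one_of_le₀ ((inftyValuation_polynomial_le this).trans ?_) zero_le
    rw [exp_le_exp]
    simp; omega
  · obtain ⟨p, q, hq0, hpq, hq, hwq, rfl⟩ := hfrac a ha
    rw [Derivation.smul_apply, hquot D₂ p q d₂ h₂ hq, smul_eq_mul, map_mul, map_div₀, map_pow,
      map_pow, hwq, RatFunc.inftyValuation.X, ← exp_nsmul, ← exp_nsmul, hd₂, hd₂]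
    rcases Nat.eq_zero_or_pos q.natDegree with h0 | h0
    · have hp : p.natDegree = 0 := by omega
      rw [derivative_of_natDegree_zero hp, derivative_of_natDegree_zero h0]
      simp
    set c := p.coeff q.natDegree / q.leadingCoeff with hc
    set r := p - C c * q with hr
    have hrd : r.natDegree ≤ q.natDegree - 1 := by
      rw [natDegree_le_iff_coeff_eq_zero]
      intro i hi
      rcases eq_or_lt_of_le (show q.natDegree ≤ i by omega) with h | h
      · rw [hr, coeff_sub, coeff_C_mul, hc, ← h, coeff_natDegree,
          div_mul_cancel₀ _ (leadingCoeff_ne_zero.mpr hq0), sub_self]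
      · rw [coeff_eq_zero_of_natDegree_lt]
        refine lt_of_le_of_lt ((natDegree_sub_le _ _).trans (max_le hpq ?_)) h
        exact natDegree_C_mul_le _ _
    have hN : q * derivative p - p * derivative q = q * derivative r - r * derivative q := by
      rw [hr]
      simp
      ring
    have hdr := natDegree_derivative_le r
    have hdq := natDegree_derivative_le q
    have : (q * derivative p - p * derivative q).natDegree ≤ 2 * q.natDegree - 2 := by
      rw [hN]
      by_cases hr0 : r.natDegree = 0
      · rw [derivative_of_natDegree_zero hr0, mul_zero, zero_sub, natDegree_neg]
        refine natDegree_mul_le.trans ?_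
        omega
      · refine (natDegree_sub_le _ _).trans (max_le ?_ ?_) <;>
        refine natDegree_mul_le.trans ?_ <;> omega
    rw [← mul_div_assoc]
    refine div_le_one_of_le₀ ((mul_le_mul_right (inftyValuation_polynomial_le this) _).trans ?_)
      zero_le
    rw [← exp_add, exp_le_exp]
    simp; omega

/-- For generators `a`, `b` of the field and any `g ≠ 0` there is a place, trivial on `ℂ(u)`, at
which `jac a b ^ α` is large compared to `g ^ β`. -/
def HasPlaces (M : Type*) [Field M] [Algebra ℂ M] (u : M) : Prop :=
  ∀ a b g : M, IntermediateField.adjoin ℂ {a, b} = ⊤ → g ≠ 0 → ∀ α β : ℕ, 0 < α →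
    ∃ (w : Valuation M ℤᵐ⁰) (D₁ D₂ : Derivation ℂ M M), IsPlace w D₁ D₂ ∧ w u = 1 ∧
      jac D₁ D₂ a b ≠ 0 ∧ w g ^ β < w (jac D₁ D₂ a b) ^ α

/-- A form of the product formula. -/
lemma hasPlaces_of_valuations {M : Type*} [Field M] [Algebra ℂ M] {u v x : M}
    {D₁ D₂ : Derivation ℂ M M} (h₁u : D₁ u = 1) (h₁v : D₁ v = 0) (h₂v : D₂ v = 1)
    {R : Type*} [CommRing R] (ι : R →+* M) (S : Set (Valuation M ℤᵐ⁰))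
    (hS : ∀ w ∈ S, IsPlace w D₁ D₂ ∧ w u = 1) (hint : ∀ φ, (∀ w ∈ S, w φ ≤ 1) → φ ∈ ι.range)
    (w' : Valuation M ℤᵐ⁰) (hw' : IsPlace w' D₁ (x ^ 2 • D₂)) (hw'u : w' u = 1)
    (hx : w' x = exp 1) (hpoly : ∀ p, ι p ≠ 0 → 1 ≤ w' (ι p)) : HasPlaces M u := by
  intro a b g hab hg α β hα
  have hJ : jac D₁ D₂ a b ≠ 0 := jac_ne_zero hab h₁u h₁v h₂v
  by_contra! hcon
  set φ := jac D₁ D₂ a b ^ α / g ^ β with hφ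
  have hφ0 : φ ≠ 0 := div_ne_zero (pow_ne_zero _ hJ) (pow_ne_zero _ hg)
  obtain ⟨p, hp⟩ := hint φ (fun w hw => by
    rw [hφ, map_div₀, map_pow, map_pow]
    exact div_le_one_of_le₀ (hcon _ _ _ (hS w hw).1 (hS w hw).2 hJ) zero_le)
  have hJ' : jac D₁ (x ^ 2 • D₂) a b = x ^ 2 * jac D₁ D₂ a b := by
    simp [jac]
    ring
  have hx0 : x ≠ 0 := by
    rintro rfl
    rw [map_zero] at hx
    exact exp_ne_zero hx.symm
  have h1 := hcon _ _ _ hw' hw'u (by rw [hJ']; exact mul_ne_zero (pow_ne_zero _ hx0) hJ)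
  have h2 := hpoly p (hp ▸ hφ0)
  have hg0 : w' g ^ β ≠ 0 := pow_ne_zero _ ((Valuation.ne_zero_iff _).mpr hg)
  rw [hp, hφ, map_div₀, map_pow, map_pow, one_le_div₀ (zero_lt_iff.mpr hg0)] at h2
  rw [hJ', map_mul, mul_pow, map_pow, hx] at h1
  have hlt : (1 : ℤᵐ⁰) < ((exp 1 : ℤᵐ⁰) ^ 2) ^ α := by
    rw [← exp_nsmul, ← exp_nsmul, ← exp_zero, exp_lt_exp]
    simpa using hα
  have hJ0 : 0 < w' (jac D₁ D₂ a b) ^ α :=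
    zero_lt_iff.mpr (pow_ne_zero _ ((Valuation.ne_zero_iff _).mpr hJ))
  have h3 := (mul_le_iff_le_one_left hJ0).mp (h1.trans h2)
  exact absurd h3 (not_le.mpr hlt)

open Classical in
lemma hasPlaces_ratFunc : HasPlaces RR (algebraMap (RatFunc ℂ)[X] RR (C RatFunc.X)) := by
  obtain ⟨d₁, d₂, D₁, D₂, hD₁, hD₂, hd₁, hd₂, hdX, hdC⟩ := exists_derivations
  refine hasPlaces_of_valuations (v := algebraMap (RatFunc ℂ)[X] RR X) ?_ ?_ ?_
    (algebraMap (RatFunc ℂ)[X] RR)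
    (Set.range fun v : IsDedekindDomain.HeightOneSpectrum (RatFunc ℂ)[X] => v.valuation RR) ?_ ?_
    _ (isPlace_infty hD₁ hD₂ hd₁ hd₂) ?_ (RatFunc.inftyValuation.X _) ?_
  · rw [hD₁, hdC, map_one]
  · rw [hD₁, hdX, map_zero]
  · rw [hD₂, hd₂, derivative_X, map_one]
  · rintro _ ⟨v, rfl⟩
    obtain ⟨hv, hc⟩ := isPlace_finite v hD₁ hD₂
    exact ⟨hv, hc _ RatFunc.X_ne_zero⟩
  · intro φ hφ
    exact IsDedekindDomain.HeightOneSpectrum.mem_integers_of_valuation_le_one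
      (R := (RatFunc ℂ)[X]) RR φ fun v => hφ _ ⟨v, rfl⟩
  · have := RatFunc.inftyValuation.C (RatFunc ℂ) (k := RatFunc.X) RatFunc.X_ne_zero
    rwa [← RatFunc.algebraMap_C] at this
  · intro p hp
    have hp0 : p ≠ 0 := by
      rintro rfl
      exact hp (map_zero _)
    rw [inftyValuation_algebraMap hp0, ← exp_zero, exp_le_exp]
    positivity

lemma HasPlaces.of_algEquiv {M M' : Type*} [Field M] [Field M'] [Algebra ℂ M] [Algebra ℂ M']
    (e : M' ≃ₐ[ℂ] M) {u : M'} (h : HasPlaces M (e u)) : HasPlaces M' u := by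
  intro a b g hab hg α β hα
  have hab' : IntermediateField.adjoin ℂ {e a, e b} = ⊤ := by
    have := congrArg (IntermediateField.map e.toAlgHom) hab
    rw [IntermediateField.adjoin_map] at this
    rw [Set.image_pair] at this
    refine Eq.trans this ?_
    rw [← AlgHom.fieldRange_eq_map]
    exact (AlgHom.fieldRange_eq_top).mpr e.surjective
  obtain ⟨w, D₁, D₂, hw, hu, hJ, hlt⟩ := h (e a) (e b) (e g) hab' (by simpa using hg) α β hα
  have hD : ∀ D : Derivation ℂ M M, ∃ D' : Derivation ℂ M' M', ∀ x, e (D' x) = D (e x) := by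
    intro D
    refine ⟨Derivation.mk' (e.symm.toLinearMap ∘ₗ D.toLinearMap ∘ₗ e.toLinearMap) fun x y => ?_,
      fun x => by simp⟩
    apply e.injective
    simp
  obtain ⟨D₁', h₁⟩ := hD D₁
  obtain ⟨D₂', h₂⟩ := hD D₂
  have hjac : ∀ x y, e (jac D₁' D₂' x y) = jac D₁ D₂ (e x) (e y) := by
    intro x y
    simp [jac, h₁, h₂]
  refine ⟨w.comap e.toRingEquiv.toRingHom, D₁', D₂', ⟨fun c hc => ?_, fun x hx => ?_, fun x hx => ?_⟩,
    hu, ?_, ?_⟩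
  · change w (e (algebraMap ℂ M' c)) = 1
    rw [e.commutes]
    exact hw.const c hc
  · change w (e (D₁' x)) ≤ 1
    rw [h₁]
    exact hw.left _ hx
  · change w (e (D₂' x)) ≤ 1
    rw [h₂]
    exact hw.right _ hx
  · intro h0
    apply hJ
    rw [← hjac, h0, map_zero]
  · change w (e g) ^ β < w (e (jac D₁' D₂' a b)) ^ α
    rw [hjac]
    exact hlt

end PlaneCremona

namespace PlaneCremona

open Polynomial WithZero

lemma mem_of_isFractionRing {P M : Type*} [CommRing P] [Field M] [Algebra P M] [IsFractionRing P M]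
    [Algebra ℂ M] (S : IntermediateField ℂ M) (h : ∀ p : P, algebraMap P M p ∈ S) (x : M) :
    x ∈ S := by
  obtain ⟨p, q, -, rfl⟩ := IsFractionRing.div_surjective (A := P) x
  exact div_mem (h p) (h q)

lemma mem_of_coeff_mem {F M : Type*} [Field F] [Algebra ℂ[X] F] [IsFractionRing ℂ[X] F] [Field M]
    [Algebra ℂ M] (S : IntermediateField ℂ M) (ψ : F[X] →+* M)
    (hC : ∀ p : ℂ[X], ψ (C (algebraMap ℂ[X] F p)) ∈ S) (hX : ψ X ∈ S) (p : F[X]) : ψ p ∈ S := by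
  induction p using Polynomial.induction_on' with
  | add p q hp hq =>
    rw [map_add]
    exact add_mem hp hq
  | monomial n k =>
    rw [← C_mul_X_pow_eq_monomial, map_mul, map_pow]
    refine mul_mem ?_ (pow_mem hX n)
    obtain ⟨p, q, -, rfl⟩ := IsFractionRing.div_surjective (A := ℂ[X]) k
    rw [show ψ (C (algebraMap ℂ[X] F p / algebraMap ℂ[X] F q)) = ψ (C (algebraMap ℂ[X] F p)) /
      ψ (C (algebraMap ℂ[X] F q)) from map_div₀ (ψ.comp C) _ _]
    exact div_mem (hC p) (hC q)

lemma exists_algEquiv_ratFunc : ∃ e : K2 ≃ₐ[ℂ] RR,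
    e X0 = algebraMap (RatFunc ℂ)[X] RR (C RatFunc.X) ∧ e X1 = algebraMap (RatFunc ℂ)[X] RR X := by
  let j : ℂ[X][X] →ₐ[ℂ] (RatFunc ℂ)[X] := mapAlgHom (Algebra.ofId ℂ[X] (RatFunc ℂ) |>.restrictScalars ℂ)
  have hj : Function.Injective j :=
    Polynomial.map_injective _ (IsFractionRing.injective ℂ[X] (RatFunc ℂ))
  let f : MvPolynomial (Fin 2) ℂ →ₐ[ℂ] RR :=
    ((Algebra.ofId (RatFunc ℂ)[X] RR).restrictScalars ℂ).comp
      (j.comp (Bivariate.equivMvPolynomial ℂ).symm.toAlgHom)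
  have hf : ∀ p, f p = algebraMap (RatFunc ℂ)[X] RR (j ((Bivariate.equivMvPolynomial ℂ).symm p)) :=
    fun p => rfl
  have hinj : Function.Injective f :=
    (IsFractionRing.injective (RatFunc ℂ)[X] RR).comp
      (hj.comp (Bivariate.equivMvPolynomial ℂ).symm.injective)
  let φ : K2 →ₐ[ℂ] RR := IsFractionRing.liftAlgHom (g := f) hinj
  have hφ : ∀ p, φ (algebraMap _ K2 p) = f p := fun p => IsFractionRing.lift_algebraMap hinj p
  have h0 : φ X0 = algebraMap (RatFunc ℂ)[X] RR (C RatFunc.X) := by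
    rw [X0, hφ, hf]
    simp [j]
  have h1 : φ X1 = algebraMap (RatFunc ℂ)[X] RR X := by
    rw [X1, hφ, hf]
    simp [j]
  have hsurj : Function.Surjective φ := by
    refine mem_of_isFractionRing φ.fieldRange (mem_of_coeff_mem φ.fieldRange _ (fun p => ?_) ⟨X1, h1⟩)
    refine ⟨algebraMap _ K2 (Bivariate.equivMvPolynomial ℂ (C p)), ?_⟩
    change φ _ = _
    rw [hφ, hf, AlgEquiv.symm_apply_apply]
    simp [j]
  exact ⟨AlgEquiv.ofBijective φ ⟨φ.toRingHom.injective, hsurj⟩, h0, h1⟩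

lemma hasPlaces_X0 : HasPlaces K2 X0 := by
  obtain ⟨e, h, -⟩ := exists_algEquiv_ratFunc
  exact HasPlaces.of_algEquiv e (h ▸ hasPlaces_ratFunc)

lemma adjoin_X0_X1 : IntermediateField.adjoin ℂ {X0, X1} = (⊤ : IntermediateField ℂ K2) := by
  rw [eq_top_iff]
  rintro x -
  have hP : ∀ p : MvPolynomial (Fin 2) ℂ,
      algebraMap _ K2 p ∈ IntermediateField.adjoin ℂ {X0, X1} := by
    intro p
    induction p using MvPolynomial.induction_on with
    | C a =>
      rw [← MvPolynomial.algebraMap_eq, ← IsScalarTower.algebraMap_apply]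
      exact IntermediateField.algebraMap_mem _ _
    | add p q hp hq =>
      rw [map_add]
      exact add_mem hp hq
    | mul_X p i hp =>
      rw [map_mul]
      refine mul_mem hp (IntermediateField.subset_adjoin ℂ {X0, X1} ?_)
      fin_cases i
      · exact Or.inl rfl
      · exact Or.inr rfl
  obtain ⟨p, q, -, rfl⟩ := IsFractionRing.div_surjective (A := MvPolynomial (Fin 2) ℂ) x
  exact div_mem (hP p) (hP q)

lemma algHom_ext {M : Type*} [Field M] [Algebra ℂ M] {f g : K2 →ₐ[ℂ] M} (h0 : f X0 = g X0)
    (h1 : f X1 = g X1) : f = g := by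
  refine AlgHom.ext fun x => ?_
  have hx : x ∈ IntermediateField.adjoin ℂ {X0, X1} := adjoin_X0_X1 ▸ IntermediateField.mem_top
  induction hx using IntermediateField.adjoin_induction with
  | mem x hx => rcases hx with rfl | rfl <;> assumption
  | algebraMap c => simp
  | add x y _ _ hx hy => simp [hx, hy]
  | inv x _ hx => simp [hx]
  | mul x y _ _ hx hy => simp [hx, hy]

lemma cremona_ext {f g : Cremona2} (h0 : f X0 = g X0) (h1 : f X1 = g X1) : f = g := by
  have := algHom_ext (f := f.toAlgHom) (g := g.toAlgHom) h0 h1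
  exact AlgEquiv.ext fun x => congrArg (fun φ => φ x) this

lemma exists_cremona {a b : K2}
    (hab : IntermediateField.adjoin ℂ {a, b} = (⊤ : IntermediateField ℂ K2)) :
    ∃ φ : Cremona2, φ X0 = a ∧ φ X1 = b := by
  have hrange : Set.range ![a, b] = {a, b} := by simp [Set.pair_comm]
  have halg : Algebra.IsAlgebraic (Algebra.adjoin ℂ (Set.range ![a, b])) K2 := by
    refine ⟨fun x => ?_⟩
    have hx : x ∈ IntermediateField.adjoin ℂ {a, b} := hab ▸ IntermediateField.mem_top
    induction hx using IntermediateField.adjoin_induction with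
    | mem x hx =>
      exact isAlgebraic_algebraMap
        (⟨x, Algebra.subset_adjoin (hrange ▸ hx)⟩ : Algebra.adjoin ℂ (Set.range ![a, b]))
    | algebraMap c =>
      rw [IsScalarTower.algebraMap_apply ℂ (Algebra.adjoin ℂ (Set.range ![a, b])) K2]
      exact isAlgebraic_algebraMap _
    | add x y _ _ hx hy => exact hx.add hy
    | inv x _ hx => exact hx.inv
    | mul x y _ _ hx hy => exact hx.mul hy
  have hind0 : AlgebraicIndependent ℂ (fun i : Fin 2 =>
      algebraMap (MvPolynomial (Fin 2) ℂ) K2 (MvPolynomial.X i)) := by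
    have : (MvPolynomial.aeval (fun i : Fin 2 =>
      algebraMap (MvPolynomial (Fin 2) ℂ) K2 (MvPolynomial.X i))) =
        (Algebra.ofId (MvPolynomial (Fin 2) ℂ) K2).restrictScalars ℂ := by
      ext i
      simp [Algebra.ofId_apply]
    rw [AlgebraicIndependent, this]
    exact IsFractionRing.injective (MvPolynomial (Fin 2) ℂ) K2
  have hind : AlgebraicIndependent ℂ ![a, b] :=
    (Algebra.IsAlgebraic.isTranscendenceBasis_of_le_trdeg_of_finite ℂ ![a, b]
      hind0.cardinalMk_le_trdeg).1
  let φ : K2 →ₐ[ℂ] K2 := IsFractionRing.liftAlgHom (g := MvPolynomial.aeval ![a, b]) hind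
  have hφ : ∀ p, φ (algebraMap _ K2 p) = MvPolynomial.aeval ![a, b] p :=
    fun p => IsFractionRing.lift_algebraMap hind p
  have h0 : φ X0 = a := by rw [X0, hφ]; simp
  have h1 : φ X1 = b := by rw [X1, hφ]; simp
  have hsurj : Function.Surjective φ := by
    rw [← AlgHom.fieldRange_eq_top, eq_top_iff, ← hab, IntermediateField.adjoin_le_iff]
    rintro x (rfl | rfl)
    · exact ⟨X0, h0⟩
    · exact ⟨X1, h1⟩
  exact ⟨AlgEquiv.ofBijective φ ⟨φ.toRingHom.injective, hsurj⟩, h0, h1⟩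

lemma adjoin_apply (g : Cremona2) :
    IntermediateField.adjoin ℂ {g X0, g X1} = (⊤ : IntermediateField ℂ K2) := by
  have := congrArg (IntermediateField.map g.toAlgHom) adjoin_X0_X1
  rw [IntermediateField.adjoin_map, Set.image_pair] at this
  refine Eq.trans this ?_
  rw [← AlgHom.fieldRange_eq_map]
  exact (AlgHom.fieldRange_eq_top).mpr g.surjective

end PlaneCremona

namespace PlaneCremona

open Polynomial IntermediateField

section Transcendental

variable {k M : Type*} [Field k] [Field M] [Algebra k M] {t s : M}

/-- The embedding of `k(X)` into `M` sending `X` to a transcendental element. -/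
def ratFuncHom (ht : Transcendental k t) : RatFunc k →ₐ[k] M :=
  (IntermediateField.val k⟮t⟯).comp (RatFunc.algEquivOfTranscendental t ht).toAlgHom

lemma ratFuncHom_X (ht : Transcendental k t) : ratFuncHom ht RatFunc.X = t := by
  simp [ratFuncHom]

lemma ratFuncHom_apply (ht : Transcendental k t) (f : RatFunc k) :
    ratFuncHom ht f = aeval t f.num / aeval t f.denom := by
  simp [ratFuncHom, RatFunc.algEquivOfTranscendental_apply]

lemma exists_ratFuncHom_eq (ht : Transcendental k t) (hs : s ∈ k⟮t⟯) :
    ∃ f, ratFuncHom ht f = s :=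
  ⟨(RatFunc.algEquivOfTranscendental t ht).symm ⟨s, hs⟩, by simp [ratFuncHom]⟩

lemma exists_algebraMap_of_isAlgebraic (ht : Transcendental k t) (hs : s ∈ k⟮t⟯)
    (h : IsAlgebraic k s) : ∃ c, algebraMap k M c = s := by
  obtain ⟨f, rfl⟩ := exists_ratFuncHom_eq ht hs
  have hf : ∃ c, f = RatFunc.C c := by
    by_contra hf
    exact f.transcendental_of_ne_C hf
      ((isAlgebraic_algHom_iff _ (ratFuncHom ht).toRingHom.injective).mp h)
  obtain ⟨c, rfl⟩ := hf
  exact ⟨c, ((ratFuncHom ht).commutes c).symm⟩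

lemma exists_moebius (ht : Transcendental k t) (hs : s ∈ k⟮t⟯) (hts : t ∈ k⟮s⟯) :
    ∃ α β γ δ : k, α * δ - β * γ ≠ 0 ∧
      s = (algebraMap k M α * t + algebraMap k M β) / (algebraMap k M γ * t + algebraMap k M δ) := by
  obtain ⟨f, rfl⟩ := exists_ratFuncHom_eq ht hs
  have htop : k⟮f⟯ = ⊤ := by
    rw [eq_top_iff, ← RatFunc.adjoin_X, adjoin_simple_le_iff]
    have h : ratFuncHom ht RatFunc.X ∈ (k⟮f⟯).map (ratFuncHom ht) := by
      rw [adjoin_map, Set.image_singleton, ratFuncHom_X]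
      exact hts
    obtain ⟨x, hx, hx'⟩ := h
    exact (ratFuncHom ht).toRingHom.injective hx' ▸ hx
  have hdeg := f.finrank_eq_max_natDegree
  rw [htop, IntermediateField.finrank_top] at hdeg
  have hn : f.num.natDegree ≤ 1 := hdeg ▸ le_max_left _ _
  have hd : f.denom.natDegree ≤ 1 := hdeg ▸ le_max_right _ _
  obtain ⟨α, β, hαβ⟩ := exists_eq_X_add_C_of_natDegree_le_one hn
  obtain ⟨γ, δ, hγδ⟩ := exists_eq_X_add_C_of_natDegree_le_one hd
  have hs' := ratFuncHom_apply ht f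
  rw [hαβ, hγδ] at hs'
  simp only [map_add, map_mul, aeval_C, aeval_X] at hs'
  refine ⟨α, β, γ, δ, fun h0 => ?_, hs'⟩
  have hne : γ ≠ 0 ∨ δ ≠ 0 := by
    by_contra! h
    exact f.denom_ne_zero (by rw [hγδ, h.1, h.2]; simp)
  have hden : algebraMap k M γ * t + algebraMap k M δ ≠ 0 := by
    have := (transcendental_iff.mp ht) f.denom
    rw [hγδ] at this
    intro h
    refine f.denom_ne_zero (hγδ.trans (this ?_))
    simpa using h
  have hconst : ∃ c, ratFuncHom ht f = algebraMap k M c := by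
    rcases hne with h | h
    · refine ⟨α / γ, ?_⟩
      have h' : algebraMap k M γ ≠ 0 := by simpa using h
      have h0' := congrArg (algebraMap k M) h0
      simp only [map_sub, map_mul, map_zero] at h0'
      rw [hs', map_div₀, div_eq_div_iff hden h']
      linear_combination -h0'
    · refine ⟨β / δ, ?_⟩
      have h' : algebraMap k M δ ≠ 0 := by simpa using h
      have h0' := congrArg (algebraMap k M) h0
      simp only [map_sub, map_mul, map_zero] at h0'
      rw [hs', map_div₀, div_eq_div_iff hden h']
      linear_combination t * h0'
  obtain ⟨c, hc⟩ := hconst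
  rw [hc, adjoin_simple_eq_bot_iff.mpr (IntermediateField.algebraMap_mem _ c)] at hts
  obtain ⟨d, rfl⟩ := mem_bot.mp hts
  exact ht (isAlgebraic_algebraMap d)

end Transcendental

lemma algebraicIndependent_X0_X1 : AlgebraicIndependent ℂ ![X0, X1] := by
  have : MvPolynomial.aeval ![X0, X1] =
      (Algebra.ofId (MvPolynomial (Fin 2) ℂ) K2).restrictScalars ℂ := by
    ext i
    fin_cases i <;> simp [Algebra.ofId_apply, X0, X1]
  rw [AlgebraicIndependent, this]
  exact IsFractionRing.injective (MvPolynomial (Fin 2) ℂ) K2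

/-- The field `ℂ(x)` inside `ℂ(x, y)`. -/
abbrev Fx : IntermediateField ℂ K2 := ℂ⟮X0⟯

lemma X0_mem : X0 ∈ Fx := mem_adjoin_simple_self ℂ X0

lemma transcendental_X0 : Transcendental ℂ X0 :=
  algebraicIndependent_X0_X1.transcendental 0

lemma transcendental_X1 : Transcendental Fx X1 := by
  have h := algebraicIndependent_X0_X1.transcendental_adjoin (s := {0}) (i := 1) (by simp)
  rw [Set.image_singleton] at h
  exact fun h' => h (isAlgebraic_adjoin_iff.mp h')

lemma adjoin_Fx_X1 : (Fx)⟮X1⟯ = ⊤ := by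
  apply restrictScalars_injective ℂ
  rw [adjoin_simple_adjoin_simple, adjoin_X0_X1, restrictScalars_top]

lemma mem_Fx_of_isAlgebraic {s : K2} (h : IsAlgebraic Fx s) : s ∈ Fx := by
  obtain ⟨c, rfl⟩ := exists_algebraMap_of_isAlgebraic transcendental_X1
    (adjoin_Fx_X1 ▸ mem_top) h
  exact c.2

lemma X1_notMem : X1 ∉ Fx := fun h =>
  transcendental_X1 (isAlgebraic_algebraMap (⟨X1, h⟩ : Fx))

end PlaneCremona

namespace PlaneCremona

open Polynomial IntermediateField

lemma exists_cremona_of_mem {a b : K2} (h0 : X0 ∈ adjoin ℂ {a, b}) (h1 : X1 ∈ adjoin ℂ {a, b}) :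
    ∃ φ : Cremona2, φ X0 = a ∧ φ X1 = b := by
  refine exists_cremona ?_
  rw [eq_top_iff, ← adjoin_X0_X1, adjoin_le_iff]
  rintro x (rfl | rfl) <;> assumption

lemma apply_eq_self {g : Cremona2} (hg : g X0 = X0) {α : K2} (hα : α ∈ Fx) : g α = α := by
  induction hα using IntermediateField.adjoin_induction with
  | mem x hx =>
    obtain rfl : x = X0 := hx
    exact hg
  | algebraMap c => simp
  | add x y _ _ hx hy => simp [hx, hy]
  | inv x _ hx => simp [hx]
  | mul x y _ _ hx hy => simp [hx, hy]

lemma apply_mem_Fx {g : Cremona2} (hg : g X0 ∈ Fx) {α : K2} (hα : α ∈ Fx) : g α ∈ Fx := by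
  induction hα using IntermediateField.adjoin_induction with
  | mem x hx =>
    obtain rfl : x = X0 := hx
    exact hg
  | algebraMap c =>
    rw [AlgEquiv.commutes]
    exact IntermediateField.algebraMap_mem _ _
  | add x y _ _ hx hy => exact map_add g x y ▸ add_mem hx hy
  | inv x _ hx => exact map_inv₀ g x ▸ inv_mem hx
  | mul x y _ _ hx hy => exact map_mul g x y ▸ mul_mem hx hy

lemma mul_X1_add_ne_zero {γ δ : K2} (hγ : γ ∈ Fx) (hδ : δ ∈ Fx) (h : γ ≠ 0 ∨ δ ≠ 0) :
    γ * X1 + δ ≠ 0 := by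
  intro h0
  by_cases hγ0 : γ = 0
  · simp_all
  · refine X1_notMem ?_
    rw [show X1 = -δ / γ by
      rw [eq_div_iff hγ0]
      linear_combination h0]
    exact div_mem (neg_mem hδ) hγ

lemma Fx_le_adjoin (z : K2) : Fx ≤ adjoin ℂ {X0, z} :=
  adjoin.mono ℂ _ _ (by simp)

lemma exists_fiberwise {α β γ δ : K2} (hα : α ∈ Fx) (hβ : β ∈ Fx) (hγ : γ ∈ Fx) (hδ : δ ∈ Fx)
    (h : α * δ - β * γ ≠ 0) :
    ∃ φ : Cremona2, φ X0 = X0 ∧ φ X1 = (α * X1 + β) / (γ * X1 + δ) := by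
  set z := (α * X1 + β) / (γ * X1 + δ) with hz
  have hmem := Fx_le_adjoin z
  have hzm : z ∈ adjoin ℂ {X0, z} := subset_adjoin ℂ _ (by simp)
  refine exists_cremona_of_mem (hmem X0_mem) ?_
  have hden : γ * X1 + δ ≠ 0 := by
    refine mul_X1_add_ne_zero hγ hδ ?_
    by_contra! h0
    simp [h0.1, h0.2] at h
  have hz' : z * (γ * X1 + δ) = α * X1 + β := div_mul_cancel₀ _ hden
  have hne : α - γ * z ≠ 0 := by
    intro h0
    have h1 : δ * z - β = 0 := by linear_combination hz' + X1 * h0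
    refine h ?_
    by_cases hγ0 : γ = 0
    · have : α = 0 := by simpa [hγ0] using h0
      simp [this, hγ0]
    · linear_combination δ * h0 + γ * h1
  rw [show X1 = (δ * z - β) / (α - γ * z) by
    rw [eq_div_iff hne]
    linear_combination -hz']
  exact div_mem (sub_mem (mul_mem (hmem hδ) hzm) (hmem hβ))
    (sub_mem (hmem hα) (mul_mem (hmem hγ) hzm))

/-- The involution exchanging the two coordinates. -/
lemma exists_swap : ∃ s : Cremona2, s X0 = X1 ∧ s X1 = X0 :=
  exists_cremona_of_mem (subset_adjoin ℂ _ (by simp)) (subset_adjoin ℂ _ (by simp))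

section NormalSubgroup

variable {N : Subgroup Cremona2}

/-- `N` contains the birational map preserving `x` and sending `y` to `z`. -/
def ContainsFiberwise (N : Subgroup Cremona2) (z : K2) : Prop := ∃ m ∈ N, m X0 = X0 ∧ m X1 = z

lemma ContainsFiberwise.mem {z : K2} (h : ContainsFiberwise N z) {m : Cremona2} (h0 : m X0 = X0)
    (h1 : m X1 = z) : m ∈ N := by
  obtain ⟨m', hm', h0', h1'⟩ := h
  rwa [cremona_ext (h0.trans h0'.symm) (h1.trans h1'.symm)]

lemma ContainsFiberwise.trans {z z' : K2} (h : ContainsFiberwise N z) (h' : ContainsFiberwise N z')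
    {z'' : K2} (hz : ∀ m : Cremona2, m X0 = X0 → m X1 = z → m z' = z'') :
    ContainsFiberwise N z'' := by
  obtain ⟨m, hm, h0, h1⟩ := h
  obtain ⟨m', hm', h0', h1'⟩ := h'
  exact ⟨m * m', mul_mem hm hm', by simp [h0', h0], by simp [h1', hz m h0 h1]⟩

lemma mem_of_conj [N.Normal] {m T φ : Cremona2} (hm : m ∈ N) (h0 : φ (m X0) = T (φ X0))
    (h1 : φ (m X1) = T (φ X1)) : T ∈ N := by
  have h : φ * m = T * φ := cremona_ext h0 h1
  rw [← mul_inv_eq_iff_eq_mul.mpr h]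
  exact ‹N.Normal›.conj_mem m hm φ

lemma ContainsFiberwise.translate [N.Normal] {η β : K2} (h : ContainsFiberwise N (X1 + η))
    (hη : η ∈ Fx) (hη0 : η ≠ 0) (hβ : β ∈ Fx) : ContainsFiberwise N (X1 + β) := by
  by_cases hβ0 : β = 0
  · exact ⟨1, one_mem _, rfl, by simp [hβ0]⟩
  obtain ⟨m, hm, hm0, hm1⟩ := h
  obtain ⟨φ, h0, h1⟩ := exists_fiberwise (div_mem hη hβ) (zero_mem Fx) (zero_mem Fx) (one_mem Fx)
    (by simp [hη0, hβ0])
  obtain ⟨T, hT0, hT1⟩ := exists_fiberwise (one_mem Fx) hβ (zero_mem Fx) (one_mem Fx) (by simp)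
  have hT1' : T X1 = X1 + β := by simpa using hT1
  refine ⟨T, mem_of_conj hm (φ := φ) (by rw [hm0, h0, hT0]) ?_, hT0, hT1'⟩
  rw [hm1, map_add, apply_eq_self h0 hη, h1, map_div₀]
  simp only [map_add, map_mul, map_zero, map_one, hT1', apply_eq_self hT0 (div_mem hη hβ)]
  field_simp
  ring

/-- A normal subgroup contains every translation along the fibres of `x`. -/
def ContainsTranslations (N : Subgroup Cremona2) : Prop :=
  ∀ β ∈ Fx, ContainsFiberwise N (X1 + β)

lemma ContainsTranslations.neg_sq_div [N.Normal] (hN : ContainsTranslations N) {β : K2}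
    (hβ : β ∈ Fx) (hβ0 : β ≠ 0) : ContainsFiberwise N (-β ^ 2 / X1) := by
  have hX1 : X1 ≠ 0 := by simpa using mul_X1_add_ne_zero (one_mem Fx) (zero_mem Fx) (by simp)
  obtain ⟨φ, h0, h1⟩ := exists_fiberwise (zero_mem Fx) (one_mem Fx) (one_mem Fx) (zero_mem Fx)
    (by simp)
  obtain ⟨U, hU0, hU1⟩ := exists_fiberwise (one_mem Fx) (zero_mem Fx) (neg_mem (inv_mem hβ))
    (one_mem Fx) (by simp)
  have hφ1 : φ X1 = X1⁻¹ := by simpa using h1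
  have hd : -β⁻¹ * X1 + 1 ≠ 0 :=
    mul_X1_add_ne_zero (neg_mem (inv_mem hβ)) (one_mem Fx) (by simp)
  have hU1' : U X1 = X1 / (-β⁻¹ * X1 + 1) := by simpa using hU1
  have hU : ContainsFiberwise N (X1 / (-β⁻¹ * X1 + 1)) := by
    obtain ⟨m, hm, hm0, hm1⟩ := hN _ (neg_mem (inv_mem hβ))
    refine ⟨U, mem_of_conj hm (φ := φ) (by rw [hm0, h0, hU0]) ?_, hU0, hU1'⟩
    rw [hm1, map_add, apply_eq_self h0 (neg_mem (inv_mem hβ)), hφ1, map_inv₀, hU1']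
    field_simp
    ring
  refine (hN β hβ).trans (hU.trans (hN β hβ) (z'' := X1 / (-β⁻¹ * X1 + 1) + β) ?_) ?_
  · intro m h0 h1
    rw [map_add, h1, apply_eq_self h0 hβ]
  · intro m h0 h1
    simp only [map_add, map_div₀, map_mul, map_neg, map_inv₀, apply_eq_self h0 hβ, h1, map_one]
    rw [show -β⁻¹ * (X1 + β) + 1 = -β⁻¹ * X1 by field_simp; ring]
    field_simp
    ring

lemma ContainsTranslations.inv [N.Normal] (hN : ContainsTranslations N) :
    ContainsFiberwise N X1⁻¹ := by
  have h := hN.neg_sq_div (IntermediateField.algebraMap_mem Fx Complex.I)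
    (by simp [Complex.I_ne_zero])
  rw [← map_pow, Complex.I_sq] at h
  simpa using h

lemma ContainsTranslations.const_mul [N.Normal] (hN : ContainsTranslations N) {c : ℂ}
    (hc : c ≠ 0) : ContainsFiberwise N (algebraMap ℂ K2 c * X1) := by
  obtain ⟨d, hd⟩ := IsAlgClosed.exists_pow_nat_eq (-c) (n := 2) (by norm_num)
  have hd0 : d ≠ 0 := by
    rintro rfl
    simp_all
  have h := hN.neg_sq_div (IntermediateField.algebraMap_mem Fx d) (by simpa using hd0)
  refine hN.inv.trans h fun m h0 h1 => ?_
  rw [← map_pow, hd, map_div₀, h1]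
  simp

lemma ContainsTranslations.swap_mem [N.Normal] (hN : ContainsTranslations N) {s : Cremona2}
    (h0 : s X0 = X1) (h1 : s X1 = X0) : s ∈ N := by
  obtain ⟨a, ha, ha0, ha1⟩ := hN X0 X0_mem
  obtain ⟨n, hn, hn0, hn1⟩ := hN.const_mul (c := -1) (by norm_num)
  have hn1' : n X1 = -X1 := by simpa using hn1
  have hb : s * a⁻¹ * s⁻¹ ∈ N := ‹N.Normal›.conj_mem _ (inv_mem ha) s
  have hs0 : s⁻¹ X0 = X1 := by rw [← h1]; exact s.symm_apply_apply X1
  have hs1 : s⁻¹ X1 = X0 := by rw [← h0]; exact s.symm_apply_apply X0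
  have ha0' : a⁻¹ X0 = X0 := by
    conv_lhs => rw [← ha0]
    exact a.symm_apply_apply X0
  have ha1' : a⁻¹ X1 = X1 - X0 := by
    have : a (X1 - X0) = X1 := by rw [map_sub, ha1, ha0]; ring
    conv_lhs => rw [← this]
    exact a.symm_apply_apply _
  have : s = n * (a * (s * a⁻¹ * s⁻¹) * a) := by
    refine cremona_ext ?_ ?_
    · simp only [AlgEquiv.mul_apply, ha0, hs0, ha1', map_sub, h0, h1, ha1, hn0, map_add, hn1']
      ring
    · simp only [AlgEquiv.mul_apply, ha0, hs0, hs1, ha0', ha1', map_sub, h0, h1, ha1, hn0, map_add,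
        hn1']
      ring
  rw [this]
  exact mul_mem hn (mul_mem (mul_mem ha hb) ha)

lemma X0_ne_zero : X0 ≠ 0 := fun h => transcendental_X0 (h ▸ isAlgebraic_zero)

lemma X1_ne_zero : X1 ≠ 0 := fun h => X1_notMem (h ▸ zero_mem _)

lemma ContainsTranslations.X0_mul [N.Normal] (hN : ContainsTranslations N) :
    ContainsFiberwise N (X0 * X1) := by
  obtain ⟨s, h0, h1⟩ := exists_swap
  have hs := hN.swap_mem h0 h1
  have hs0 : s⁻¹ X0 = X1 := by rw [← h1]; exact s.symm_apply_apply X1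
  have hs1 : s⁻¹ X1 = X0 := by rw [← h0]; exact s.symm_apply_apply X0
  obtain ⟨i, hi, hi0, hi1⟩ := hN.inv
  obtain ⟨τ, hτ0, hτ1⟩ := exists_fiberwise X0_mem (zero_mem Fx) (zero_mem Fx) (one_mem Fx)
    (by simpa using X0_ne_zero)
  replace hτ1 : τ X1 = X0 * X1 := by simpa using hτ1
  have hτ1' : τ⁻¹ X1 = X1 / X0 := by
    have : τ (X1 / X0) = X1 := by rw [map_div₀, hτ1, hτ0, mul_div_cancel_left₀ _ X0_ne_zero]
    conv_lhs => rw [← this]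
    exact τ.symm_apply_apply _
  have hτ0' : τ⁻¹ X0 = X0 := by
    conv_lhs => rw [← hτ0]
    exact τ.symm_apply_apply X0
  have key : i * s = (τ * s * τ⁻¹) * s⁻¹ * τ := by
    have := X0_ne_zero
    have := X1_ne_zero
    refine cremona_ext ?_ ?_
    · simp only [AlgEquiv.mul_apply, hτ0, hτ1, hs0, hτ1', h0, h1, map_div₀, hi1]
      field_simp
    · simp only [AlgEquiv.mul_apply, map_mul, hτ0, hτ1, hs0, hs1, hτ0', hτ1', h0, h1, map_div₀, hi0]
      field_simp
  refine ⟨τ, ?_, hτ0, hτ1⟩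
  have h := mul_mem hi hs
  rw [key] at h
  exact (N.mul_mem_cancel_left
    (mul_mem (‹N.Normal›.conj_mem s hs τ) (inv_mem hs))).mp h

lemma ContainsTranslations.X0_sub_mul [N.Normal] (hN : ContainsTranslations N) (c : ℂ) :
    ContainsFiberwise N ((X0 - algebraMap ℂ K2 c) * X1) := by
  obtain ⟨m, hm, hm0, hm1⟩ := hN.X0_mul
  obtain ⟨φ, h0, h1⟩ : ∃ φ : Cremona2, φ X0 = X0 - algebraMap ℂ K2 c ∧ φ X1 = X1 := by
    refine exists_cremona_of_mem ?_ (subset_adjoin ℂ _ (by simp))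
    have : X0 - algebraMap ℂ K2 c ∈ adjoin ℂ {X0 - algebraMap ℂ K2 c, X1} :=
      subset_adjoin ℂ _ (by simp)
    simpa using add_mem this (IntermediateField.algebraMap_mem _ c)
  have hmem : X0 - algebraMap ℂ K2 c ∈ Fx :=
    sub_mem X0_mem (IntermediateField.algebraMap_mem _ c)
  have hne : X0 - algebraMap ℂ K2 c ≠ 0 := fun h =>
    transcendental_X0 (sub_eq_zero.mp h ▸ isAlgebraic_algebraMap c)
  obtain ⟨T, hT0, hT1⟩ := exists_fiberwise hmem (zero_mem Fx) (zero_mem Fx) (one_mem Fx)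
    (by simpa using hne)
  replace hT1 : T X1 = (X0 - algebraMap ℂ K2 c) * X1 := by simpa using hT1
  refine ⟨T, mem_of_conj hm (φ := φ) ?_ ?_, hT0, hT1⟩
  · rw [hm0, h0, map_sub, hT0, AlgEquiv.commutes]
  · rw [hm1, map_mul, h0, h1, hT1]

lemma ContainsTranslations.aeval_mul [N.Normal] (hN : ContainsTranslations N) {p : ℂ[X]}
    (hp : p ≠ 0) : ContainsFiberwise N (aeval X0 p * X1) := by
  have hmem : ∀ q : ℂ[X], aeval X0 q ∈ Fx := fun q =>
    algebra_adjoin_le_adjoin ℂ _ (aeval_mem_adjoin_singleton ℂ X0)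
  rw [(IsAlgClosed.splits p).eq_prod_roots, map_mul, aeval_C]
  generalize p.roots = r
  have hmul : ∀ q q' : ℂ[X], ContainsFiberwise N (aeval X0 q * X1) →
      ContainsFiberwise N (aeval X0 q' * X1) → ContainsFiberwise N (aeval X0 (q * q') * X1) := by
    intro q q' h h'
    refine h.trans h' fun m h0 h1 => ?_
    rw [map_mul, apply_eq_self h0 (hmem q'), h1, map_mul]
    ring
  rw [← aeval_C X0 p.leadingCoeff, ← map_mul]
  induction r using Multiset.induction_on with
  | empty =>
    simpa using hN.const_mul (leadingCoeff_ne_zero.mpr hp)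
  | cons c r ih =>
    rw [Multiset.map_cons, Multiset.prod_cons, mul_left_comm]
    exact hmul _ _ (by simpa using hN.X0_sub_mul c) ih

lemma ContainsTranslations.mul [N.Normal] (hN : ContainsTranslations N) {α : K2} (hα : α ∈ Fx)
    (hα0 : α ≠ 0) : ContainsFiberwise N (α * X1) := by
  obtain ⟨p, q, rfl⟩ := mem_adjoin_simple_iff ℂ α |>.mp hα
  have hmem : ∀ q : ℂ[X], aeval X0 q ∈ Fx := fun q =>
    algebra_adjoin_le_adjoin ℂ _ (aeval_mem_adjoin_singleton ℂ X0)
  obtain ⟨hp, hq⟩ := div_ne_zero_iff.mp hα0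
  have hp0 : p ≠ 0 := fun h => hp (by simp [h])
  have hq0 : q ≠ 0 := fun h => hq (by simp [h])
  have hq' : ContainsFiberwise N ((aeval X0 q)⁻¹ * X1) := by
    obtain ⟨m, hm, h0, h1⟩ := hN.aeval_mul hq0
    refine ⟨m⁻¹, inv_mem hm, ?_, ?_⟩
    · conv_lhs => rw [← h0]
      exact m.symm_apply_apply X0
    · have : m ((aeval X0 q)⁻¹ * X1) = X1 := by
        rw [map_mul, map_inv₀, apply_eq_self h0 (hmem q), h1, inv_mul_cancel_left₀ hq]
      conv_lhs => rw [← this]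
      exact m.symm_apply_apply _
  refine (hN.aeval_mul hp0).trans hq' fun m h0 h1 => ?_
  rw [map_mul, apply_eq_self h0 (inv_mem (hmem q)), h1]
  ring

lemma ContainsTranslations.affine [N.Normal] (hN : ContainsTranslations N) {α β : K2}
    (hα : α ∈ Fx) (hβ : β ∈ Fx) (hα0 : α ≠ 0) : ContainsFiberwise N (α * X1 + β) :=
  (hN.mul hα hα0).trans (hN β hβ) fun m h0 h1 => by rw [map_add, apply_eq_self h0 hβ, h1]

lemma ContainsTranslations.moebius [N.Normal] (hN : ContainsTranslations N) {α β γ δ : K2}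
    (hα : α ∈ Fx) (hβ : β ∈ Fx) (hγ : γ ∈ Fx) (hδ : δ ∈ Fx) (h : α * δ - β * γ ≠ 0) :
    ContainsFiberwise N ((α * X1 + β) / (γ * X1 + δ)) := by
  by_cases hγ0 : γ = 0
  · subst hγ0
    have h' : α ≠ 0 ∧ δ ≠ 0 := by simpa using h
    have := hN.affine (div_mem hα hδ) (div_mem hβ hδ) (div_ne_zero h'.1 h'.2)
    convert this using 1
    have := h'.2
    rw [zero_mul, zero_add]
    field_simp
  · have h1 := (hN.affine hγ hδ hγ0).trans hN.inv (z'' := (γ * X1 + δ)⁻¹)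
      fun m h0 h1 => by rw [map_inv₀, h1]
    have hα' : (β - α * δ / γ) ∈ Fx := sub_mem hβ (div_mem (mul_mem hα hδ) hγ)
    have hα'0 : β - α * δ / γ ≠ 0 := by
      intro h2
      field_simp at h2
      exact h (by linear_combination -h2)
    refine h1.trans (hN.affine hα' (div_mem hα hγ) hα'0) fun m h0 h1 => ?_
    have := mul_X1_add_ne_zero hγ hδ (Or.inl hγ0)
    rw [map_add, map_mul, apply_eq_self h0 hα', apply_eq_self h0 (div_mem hα hγ), h1]
    field_simp
    ring

lemma ContainsTranslations.moebius_left [N.Normal] (hN : ContainsTranslations N) {α β γ δ : ℂ}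
    (h : α * δ - β * γ ≠ 0) :
    ∃ m ∈ N, m X0 = (algebraMap ℂ K2 α * X0 + algebraMap ℂ K2 β) /
      (algebraMap ℂ K2 γ * X0 + algebraMap ℂ K2 δ) ∧ m X1 = X1 := by
  have hc := IntermediateField.algebraMap_mem Fx
  obtain ⟨m, hm, h0, h1⟩ := hN.moebius (hc α) (hc β) (hc γ) (hc δ)
    (by simpa [← map_mul, ← map_sub] using h)
  obtain ⟨s, hs0, hs1⟩ := exists_swap
  have hs := hN.swap_mem hs0 hs1
  refine ⟨s * m * s, mul_mem (mul_mem hs hm) hs, ?_, ?_⟩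
  · simp [hs0, h1, hs1]
  · simp [hs1, h0, hs0]

lemma ContainsTranslations.mem_of_X0_fixed [N.Normal] (hN : ContainsTranslations N) {g : Cremona2}
    (hg : g X0 = X0) : g ∈ N := by
  have htop : (Fx)⟮g X1⟯ = ⊤ := by
    apply restrictScalars_injective ℂ
    rw [adjoin_simple_adjoin_simple, restrictScalars_top]
    have := adjoin_apply g
    rwa [hg] at this
  obtain ⟨α, β, γ, δ, hdet, h⟩ := exists_moebius (s := g X1) transcendental_X1
    (adjoin_Fx_X1 ▸ mem_top) (htop ▸ mem_top)
  refine (hN.moebius α.2 β.2 γ.2 δ.2 ?_).mem hg h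
  exact fun h0 => hdet (Subtype.ext h0)

lemma ContainsTranslations.mem_of_X0_mem [N.Normal] (hN : ContainsTranslations N) {g : Cremona2}
    (hg : g X0 ∈ Fx) : g ∈ N := by
  have hmap : Fx.map g.toAlgHom = ℂ⟮g X0⟯ := by
    rw [adjoin_map, Set.image_singleton]
    rfl
  have hX0 : X0 ∈ ℂ⟮g X0⟯ := by
    obtain ⟨p, q, hpq⟩ := (mem_adjoin_simple_iff ℂ (g X0)).mp hg
    have hq : aeval X0 q ≠ 0 := by
      intro hq
      rw [hq, div_zero, map_eq_zero_iff g g.injective] at hpq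
      exact X0_ne_zero hpq
    have : IsAlgebraic Fx (g.symm X0) := by
      refine ⟨p.map (algebraMap ℂ Fx) - C ⟨X0, X0_mem⟩ * q.map (algebraMap ℂ Fx), ?_, ?_⟩
      · intro h
        obtain ⟨i, hi⟩ : ∃ i, q.coeff i ≠ 0 := by
          by_contra! h0
          exact hq (by rw [show q = 0 from Polynomial.ext h0, map_zero])
        have h' := congrArg (fun r => algebraMap Fx K2 (coeff r i)) h
        simp only [coeff_sub, coeff_map, coeff_C_mul, coeff_zero, map_sub, map_mul, map_zero,
          ← IsScalarTower.algebraMap_apply] at h'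
        have h'' : X0 = algebraMap ℂ K2 (p.coeff i / q.coeff i) := by
          rw [map_div₀, eq_div_iff (by simpa using hi)]
          exact (sub_eq_zero.mp h').symm
        exact transcendental_X0 (h'' ▸ isAlgebraic_algebraMap _)
      · apply g.injective
        rw [map_sub, map_mul, aeval_C, aeval_map_algebraMap, aeval_map_algebraMap, map_sub,
          map_mul, ← aeval_algHom_apply, ← aeval_algHom_apply, g.apply_symm_apply, map_zero]
        change aeval X0 p - g X0 * aeval X0 q = 0
        rw [hpq, div_mul_cancel₀ _ hq, sub_self]
    have hmem := mem_Fx_of_isAlgebraic this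
    rw [← hmap]
    exact ⟨g.symm X0, hmem, g.apply_symm_apply X0⟩
  obtain ⟨α, β, γ, δ, hdet, h⟩ := exists_moebius transcendental_X0 hg hX0
  obtain ⟨m, hm, h0, -⟩ := hN.moebius_left hdet
  rw [← N.mul_mem_cancel_left (inv_mem hm)]
  refine hN.mem_of_X0_fixed ?_
  rw [AlgEquiv.mul_apply, h, ← h0]
  exact m.symm_apply_apply X0

end NormalSubgroup

end PlaneCremona

namespace PlaneCremona

open Polynomial IntermediateField

/-- The affine linear form with coefficient vector `u`. -/
def linForm (u : Fin 3 → ℂ) : K2 := lin2 (u 0) (u 1) (u 2)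

lemma linForm_ne_zero {u : Fin 3 → ℂ} (hu : u ≠ 0) : linForm u ≠ 0 := by
  have hc := IntermediateField.algebraMap_mem Fx
  intro h
  refine hu ?_
  have h' : algebraMap ℂ K2 (u 1) * X1 + (algebraMap ℂ K2 (u 0) * X0 + algebraMap ℂ K2 (u 2)) = 0 := by
    rw [← h, linForm, lin2]
    ring
  have h1 : u 1 = 0 ∧ algebraMap ℂ K2 (u 0) * X0 + algebraMap ℂ K2 (u 2) = 0 := by
    by_contra h1
    refine mul_X1_add_ne_zero (hc _) (add_mem (mul_mem (hc _) X0_mem) (hc _)) ?_ h'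
    rw [← not_and_or]
    simpa using h1
  have h0 : u 0 = 0 := by
    by_contra h0
    have : X0 = algebraMap ℂ K2 (-u 2 / u 0) := by
      rw [map_div₀, map_neg, eq_div_iff (by simpa using h0)]
      linear_combination h1.2
    exact transcendental_X0 (this ▸ isAlgebraic_algebraMap _)
  have h2 : u 2 = 0 := by simpa [h0] using h1.2
  ext i
  fin_cases i
  · exact h0
  · exact h1.1
  · exact h2

lemma linForm_mul (M U : Matrix (Fin 3) (Fin 3) ℂ) (i : Fin 3) :
    linForm ((M * U) i) = algebraMap ℂ K2 (M i 0) * linForm (U 0) +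
      algebraMap ℂ K2 (M i 1) * linForm (U 1) + algebraMap ℂ K2 (M i 2) * linForm (U 2) := by
  simp only [linForm, lin2, Matrix.mul_apply, Fin.sum_univ_three, map_add, map_mul]
  ring

lemma apply_linForm {f : Cremona2} {A : Matrix (Fin 3) (Fin 3) ℂ} (hA : linForm (A 2) ≠ 0)
    (h0 : f X0 = linForm (A 0) / linForm (A 2)) (h1 : f X1 = linForm (A 1) / linForm (A 2))
    (U : Matrix (Fin 3) (Fin 3) ℂ) (i : Fin 3) :
    f (linForm (U i)) = linForm ((U * A) i) / linForm (A 2) := by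
  rw [linForm_mul, linForm, lin2]
  simp only [map_add, map_mul, AlgEquiv.commutes, h0, h1]
  field_simp

/-- Every complex `3 × 3` matrix is conjugate to one fixing the last coordinate direction. -/
lemma exists_conj_col (A : Matrix (Fin 3) (Fin 3) ℂ) : ∃ U V M : Matrix (Fin 3) (Fin 3) ℂ,
    U * V = 1 ∧ V * U = 1 ∧ U * A = M * U ∧ M 0 2 = 0 ∧ M 1 2 = 0 := by
  obtain ⟨μ, hμ⟩ := Module.End.exists_eigenvalue (Matrix.toLin' A)
  obtain ⟨v, hv⟩ := hμ.exists_hasEigenvector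
  have he : (Pi.single 2 1 : Fin 3 → ℂ) ≠ 0 := by simp
  obtain ⟨e, hE⟩ := SeparatingDual.exists_continuousLinearEquiv_apply_eq (R := ℂ) hv.2 he
  let U := LinearMap.toMatrix' (e : (Fin 3 → ℂ) →ₗ[ℂ] (Fin 3 → ℂ))
  let V := LinearMap.toMatrix' (e.symm : (Fin 3 → ℂ) →ₗ[ℂ] (Fin 3 → ℂ))
  have hUV : U * V = 1 := by
    rw [← LinearMap.toMatrix'_comp, ← LinearMap.toMatrix'_id]
    exact congrArg _ (LinearMap.ext fun x => e.apply_symm_apply x)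
  have hVU : V * U = 1 := mul_eq_one_comm.mp hUV
  have hU : U.mulVec v = Pi.single 2 1 := by
    rw [LinearMap.toMatrix'_mulVec]
    exact hE
  have hV : V.mulVec (Pi.single 2 1) = v := by
    rw [← hU, Matrix.mulVec_mulVec, hVU, Matrix.one_mulVec]
  have hM : (U * A * V).mulVec (Pi.single 2 1) = μ • Pi.single 2 1 := by
    rw [← Matrix.mulVec_mulVec, hV, ← Matrix.mulVec_mulVec]
    have : A.mulVec v = μ • v := by simpa using hv.apply_eq_smul
    rw [this, Matrix.mulVec_smul, hU]
  refine ⟨U, V, U * A * V, hUV, hVU, ?_, ?_, ?_⟩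
  · rw [Matrix.mul_assoc (U * A), hVU, Matrix.mul_one]
  · simpa using congrFun hM 0
  · simpa using congrFun hM 1

section NormalSubgroup

variable {N : Subgroup Cremona2} [N.Normal]

lemma exists_mem_triangular {A : Cremona2} (hA : IsLinearAut A) (hA1 : A ≠ 1) (hAN : A ∈ N) :
    ∃ B ∈ N, B ≠ 1 ∧ B X0 ∈ Fx ∧ ∃ κ ∈ Fx, ∃ q ∈ Fx, B X1 = κ * X1 + q := by
  obtain ⟨A', hA', h0, h1⟩ := hA
  obtain ⟨U, V, M, hUV, hVU, hM, hM0, hM1⟩ := exists_conj_col A'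
  have row_ne_zero : ∀ P Q : Matrix (Fin 3) (Fin 3) ℂ, P * Q = 1 → ∀ i, P i ≠ 0 := by
    intro P Q h i hi
    have := congrFun (congrFun h i) i
    rw [Matrix.mul_apply, hi] at this
    simp at this
  have hA2 : linForm (A' 2) ≠ 0 := by
    obtain ⟨u, rfl⟩ := hA'
    exact linForm_ne_zero (row_ne_zero _ _ u.mul_inv 2)
  have hU := fun i => linForm_ne_zero (row_ne_zero U V hUV i)
  obtain ⟨φ, hφ0, hφ1⟩ : ∃ φ : Cremona2, φ X0 = linForm (U 0) / linForm (U 1) ∧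
      φ X1 = linForm (U 2) / linForm (U 1) := by
    set S := adjoin ℂ {linForm (U 0) / linForm (U 1), linForm (U 2) / linForm (U 1)}
    have hS0 : linForm (U 0) / linForm (U 1) ∈ S := subset_adjoin ℂ _ (by simp)
    have hS2 : linForm (U 2) / linForm (U 1) ∈ S := subset_adjoin ℂ _ (by simp)
    have hc := IntermediateField.algebraMap_mem S
    have hquot : ∀ i, linForm ((1 : Matrix (Fin 3) (Fin 3) ℂ) i) / linForm (U 1) ∈ S := by
      intro i
      rw [← hVU, linForm_mul, add_div, add_div, mul_div_assoc, mul_div_assoc, mul_div_assoc,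
        div_self (hU 1)]
      exact add_mem (add_mem (mul_mem (hc _) hS0) (mul_mem (hc _) (one_mem S)))
        (mul_mem (hc _) hS2)
    have h2 : linForm ((1 : Matrix (Fin 3) (Fin 3) ℂ) 2) = 1 := by simp [linForm, lin2]
    have h0 : linForm ((1 : Matrix (Fin 3) (Fin 3) ℂ) 0) = X0 := by simp [linForm, lin2]
    have h1 : linForm ((1 : Matrix (Fin 3) (Fin 3) ℂ) 1) = X1 := by simp [linForm, lin2]
    refine exists_cremona_of_mem ?_ ?_
    · have := div_mem (hquot 0) (hquot 2)
      rwa [div_div_div_cancel_right₀ (hU 1), h0, h2, div_one] at this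
    · have := div_mem (hquot 1) (hquot 2)
      rwa [div_div_div_cancel_right₀ (hU 1), h1, h2, div_one] at this
  have hAU : ∀ i, A (linForm (U i)) / (linForm (U 1) / linForm (A' 2)) =
      φ (algebraMap ℂ K2 (M i 0) * X0 + algebraMap ℂ K2 (M i 1) +
        algebraMap ℂ K2 (M i 2) * X1) := by
    intro i
    rw [apply_linForm hA2 h0 h1, hM, linForm_mul]
    simp only [map_add, map_mul, AlgEquiv.commutes, hφ0, hφ1]
    have := hU 1
    field_simp
  have hne : linForm (U 1) / linForm (A' 2) ≠ 0 := div_ne_zero (hU 1) hA2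
  have hinv : ∀ z w, A (φ z) = φ w → (φ⁻¹ * A * φ⁻¹⁻¹) z = w := by
    intro z w h
    rw [inv_inv, AlgEquiv.mul_apply, AlgEquiv.mul_apply, h]
    exact φ.symm_apply_apply w
  have hc := IntermediateField.algebraMap_mem Fx
  have hd : algebraMap ℂ K2 (M 1 0) * X0 + algebraMap ℂ K2 (M 1 1) ∈ Fx :=
    add_mem (mul_mem (hc _) X0_mem) (hc _)
  refine ⟨φ⁻¹ * A * φ⁻¹⁻¹, ‹N.Normal›.conj_mem A hAN _, ?_, ?_,
    algebraMap ℂ K2 (M 2 2) / (algebraMap ℂ K2 (M 1 0) * X0 + algebraMap ℂ K2 (M 1 1)),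
    div_mem (hc _) hd,
    (algebraMap ℂ K2 (M 2 0) * X0 + algebraMap ℂ K2 (M 2 1)) /
      (algebraMap ℂ K2 (M 1 0) * X0 + algebraMap ℂ K2 (M 1 1)),
    div_mem (add_mem (mul_mem (hc _) X0_mem) (hc _)) hd, ?_⟩
  · exact fun h => hA1 (conj_eq_one_iff.mp h)
  · rw [hinv X0 ((algebraMap ℂ K2 (M 0 0) * X0 + algebraMap ℂ K2 (M 0 1)) /
      (algebraMap ℂ K2 (M 1 0) * X0 + algebraMap ℂ K2 (M 1 1)))]
    · exact div_mem (add_mem (mul_mem (hc _) X0_mem) (hc _)) hd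
    · have h0 := hAU 0
      have h1 := hAU 1
      rw [hM0, map_zero, zero_mul, add_zero] at h0
      rw [hM1, map_zero, zero_mul, add_zero] at h1
      rw [hφ0, map_div₀, map_div₀ φ, ← h0, ← h1, div_div_div_cancel_right₀ hne]
  · refine hinv _ _ ?_
    have h2 := hAU 2
    have h1 := hAU 1
    rw [hM1, map_zero, zero_mul, add_zero] at h1
    rw [hφ1, map_div₀, div_mul_eq_mul_div, ← add_div, map_div₀ φ, add_comm, ← h1, ← h2,
      div_div_div_cancel_right₀ hne]

lemma exists_containsFiberwise_add {B : Cremona2} (hB : B ∈ N) (hB1 : B ≠ 1) (h0 : B X0 ∈ Fx)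
    {κ q : K2} (hκ : κ ∈ Fx) (hq : q ∈ Fx) (h1 : B X1 = κ * X1 + q) :
    ∃ η ∈ Fx, η ≠ 0 ∧ ContainsFiberwise N (X1 + η) := by
  have hκ0 : κ ≠ 0 := by
    rintro rfl
    have hle : (⊤ : IntermediateField ℂ K2) ≤ Fx := by
      rw [← adjoin_apply B, adjoin_le_iff]
      rintro x (rfl | rfl)
      · exact h0
      · rw [SetLike.mem_coe, h1]
        simpa using hq
    exact X1_notMem (hle mem_top)
  have hT : ∀ β ∈ Fx, ∃ T : Cremona2, T X0 = X0 ∧ T X1 = X1 + β := fun β hβ => by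
    simpa using exists_fiberwise (one_mem Fx) hβ (zero_mem Fx) (one_mem Fx) (by simp)
  by_cases h : ∀ β ∈ Fx, B β = κ * β
  · have hκ1 : κ = 1 := by simpa using (h 1 (one_mem Fx)).symm
    subst hκ1
    have hB0 : B X0 = X0 := by simpa using h X0 X0_mem
    rw [one_mul] at h1
    refine ⟨q, hq, ?_, B, hB, hB0, h1⟩
    rintro rfl
    exact hB1 (cremona_ext hB0 (by simpa using h1))
  · push Not at h
    obtain ⟨β, hβ, hne⟩ := h
    have hβ' : B β / κ ∈ Fx := div_mem (apply_mem_Fx h0 hβ) hκ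
    refine ⟨B β / κ - β, sub_mem hβ' hβ, ?_, ?_⟩
    · rw [sub_ne_zero, ne_eq, div_eq_iff hκ0, mul_comm]
      exact hne
    obtain ⟨T, hT0, hT1⟩ := hT β hβ
    obtain ⟨T', hT0', hT1'⟩ := hT _ hβ'
    have hcomm : B * T = T' * B := by
      refine cremona_ext ?_ ?_
      · simp only [AlgEquiv.mul_apply, hT0]
        rw [apply_eq_self hT0' h0]
      · simp only [AlgEquiv.mul_apply, hT1, h1, map_add, map_mul, hT1']
        rw [apply_eq_self hT0' hκ, apply_eq_self hT0' hq]
        field_simp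
        ring
    have hT0i : T⁻¹ X0 = X0 := by
      conv_lhs => rw [← hT0]
      exact T.symm_apply_apply X0
    have hT1i : T⁻¹ X1 = X1 - β := by
      have : T (X1 - β) = X1 := by rw [map_sub, hT1, apply_eq_self hT0 hβ]; ring
      conv_lhs => rw [← this]
      exact T.symm_apply_apply _
    refine ⟨T' * T⁻¹, ?_, ?_, ?_⟩
    · have : T' * T⁻¹ = B * (T * B⁻¹ * T⁻¹) := by
        rw [← mul_inv_eq_iff_eq_mul.mpr hcomm]
        group
      rw [this]
      exact mul_mem hB (‹N.Normal›.conj_mem _ (inv_mem hB) T)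
    · rw [AlgEquiv.mul_apply, hT0i, hT0']
    · rw [AlgEquiv.mul_apply, hT1i, map_sub, hT1', apply_eq_self hT0' hβ]
      ring

lemma containsTranslations_of_linear {A : Cremona2} (hA : IsLinearAut A) (hA1 : A ≠ 1)
    (hAN : A ∈ N) : ContainsTranslations N := by
  obtain ⟨B, hB, hB1, h0, κ, hκ, q, hq, h1⟩ := exists_mem_triangular hA hA1 hAN
  obtain ⟨η, hη, hη0, h⟩ := exists_containsFiberwise_add hB hB1 h0 hκ hq h1
  exact fun β hβ => h.translate hη hη0 hβ

end NormalSubgroup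

end PlaneCremona

namespace PlaneCremona

open Polynomial WithZero

/-- All monomials `x ^ i * y ^ j` of `F` satisfy `i + e * j ≤ B`. -/
def WeightLE (e B : ℕ) (F : ℂ[X][X]) : Prop :=
  ∀ i j, (F.coeff j).coeff i ≠ 0 → i + e * j ≤ B

/-- Some monomial `x ^ i * y ^ j` of `F` satisfies `i + e * j = B`. -/
def AttainsWeight (e B : ℕ) (F : ℂ[X][X]) : Prop :=
  ∃ i j, i + e * j = B ∧ (F.coeff j).coeff i ≠ 0

/-- The polynomial `x ^ B * F(1 / x, y / x ^ e)`. -/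
def inftyTransform (e B : ℕ) (F : ℂ[X][X]) : ℂ[X][X] :=
  ∑ j ∈ Finset.range (F.natDegree + 1), monomial j (reflect (B - e * j) (F.coeff j))

lemma coeff_inftyTransform (e B : ℕ) (F : ℂ[X][X]) (j : ℕ) :
    (inftyTransform e B F).coeff j = reflect (B - e * j) (F.coeff j) := by
  simp only [inftyTransform, finsetSum_coeff, coeff_monomial]
  rw [Finset.sum_ite_eq' (Finset.range (F.natDegree + 1)) j]
  split_ifs with h
  · rfl
  · rw [coeff_eq_zero_of_natDegree_lt (by simpa using h), reflect_zero]

lemma natDegree_inftyTransform_le (e B : ℕ) {F : ℂ[X][X]} {n : ℕ} (h : F.natDegree ≤ n) :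
    (inftyTransform e B F).natDegree ≤ n := by
  rw [natDegree_le_iff_coeff_eq_zero]
  intro j hj
  rw [coeff_inftyTransform, coeff_eq_zero_of_natDegree_lt (h.trans_lt hj), reflect_zero]

lemma WeightLE.inftyTransform {e B : ℕ} {F : ℂ[X][X]} (h : WeightLE e B F) :
    WeightLE e B (inftyTransform e B F) := by
  intro i j hij
  rw [coeff_inftyTransform, coeff_reflect] at hij
  have h1 := h _ _ hij
  by_cases hi : i ≤ B - e * j
  · omega
  · rw [revAt_eq_self_of_lt (by omega)] at h1
    exact h1

lemma inftyTransform_map_eval_zero_ne_zero {e B : ℕ} {F : ℂ[X][X]} (h : AttainsWeight e B F) :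
    (inftyTransform e B F).map (evalRingHom 0) ≠ 0 := by
  obtain ⟨i, j, hij, h0⟩ := h
  intro hz
  apply h0
  have := congrArg (fun p => coeff p j) hz
  simp only [coeff_map, coeff_inftyTransform, coe_evalRingHom, coeff_zero,
    ← coeff_zero_eq_eval_zero, coeff_reflect, revAt_le (Nat.zero_le _)] at this
  rwa [show B - e * j - 0 = i by omega] at this

lemma swap_map_eval_zero (F : ℂ[X][X]) :
    (Bivariate.swap F).map (evalRingHom 0) = F.coeff 0 := by
  ext j
  rw [coeff_map, coe_evalRingHom, ← coeff_zero_eq_eval_zero, coeff_swap]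

lemma natDegree_reflect_le_of_le {F : ℂ[X][X]} {n : ℕ} (h : F.natDegree ≤ n) :
    (reflect n F).natDegree ≤ n :=
  natDegree_reflect_le.trans (by simp [h])

lemma AttainsWeight.swap {B : ℕ} {F : ℂ[X][X]} (h : AttainsWeight 1 B F) :
    AttainsWeight 1 B (Bivariate.swap F) := by
  obtain ⟨i, j, hij, h0⟩ := h
  exact ⟨j, i, by omega, by rwa [coeff_swap]⟩

lemma WeightLE.swap {B : ℕ} {F : ℂ[X][X]} (h : WeightLE 1 B F) :
    WeightLE 1 B (Bivariate.swap F) := by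
  intro i j hij
  rw [coeff_swap] at hij
  have := h _ _ hij
  omega

section

variable {M : Type*} [Field M] [Algebra ℂ M]

lemma ev_reflect (a : M) {b : M} (hb : b ≠ 0) {F : ℂ[X][X]} {n : ℕ} (h : F.natDegree ≤ n) :
    ev a b⁻¹ (reflect n F) * b ^ n = ev a b F := by
  let : Invertible b := invertibleOfNonzero hb
  rw [ev_eq_eval₂, ev_eq_eval₂, ← invOf_eq_inv]
  exact eval₂_reflect_mul_pow _ _ _ _ h

lemma aeval_reflect {a : M} (ha : a ≠ 0) {p : ℂ[X]} {n : ℕ} (h : p.natDegree ≤ n) :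
    aeval a⁻¹ (reflect n p) * a ^ n = aeval a p := by
  let : Invertible a := invertibleOfNonzero ha
  rw [aeval_def, aeval_def, ← invOf_eq_inv]
  exact eval₂_reflect_mul_pow _ _ _ _ h

lemma ev_inftyTransform {a : M} (ha : a ≠ 0) (b : M) {e B : ℕ} {F : ℂ[X][X]}
    (h : WeightLE e B F) :
    ev a⁻¹ (a⁻¹ ^ e * b) (inftyTransform e B F) * a ^ B = ev a b F := by
  rw [ev_expand _ _ _ _ (natDegree_inftyTransform_le e B le_rfl), ev_expand _ _ _ _ le_rfl,
    Finset.sum_mul]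
  refine Finset.sum_congr rfl fun j _ => ?_
  rw [coeff_inftyTransform]
  by_cases hj : F.coeff j = 0
  · simp [hj]
  have hle : (F.coeff j).natDegree + e * j ≤ B := h _ _ (by simpa using hj)
  rw [← aeval_reflect ha (show (F.coeff j).natDegree ≤ B - e * j by omega)]
  obtain ⟨t, rfl⟩ : ∃ t, B = t + e * j := ⟨B - e * j, by omega⟩
  rw [Nat.add_sub_cancel, pow_add, mul_pow, ← pow_mul]
  have : a⁻¹ ^ (e * j) * a ^ (e * j) = 1 := by rw [← mul_pow, inv_mul_cancel₀ ha, one_pow]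
  linear_combination (aeval a⁻¹ (reflect t (F.coeff j)) * b ^ j * a ^ t) * this

variable {D₁ D₂ : Derivation ℂ M M}

lemma jac_inv_left (a b : M) :
    jac D₁ D₂ a⁻¹ b = -(a⁻¹ ^ 2) * jac D₁ D₂ a b := by
  simp only [jac, Derivation.leibniz_inv, smul_eq_mul]
  ring

lemma jac_inv_right (a b : M) :
    jac D₁ D₂ a b⁻¹ = -(b⁻¹ ^ 2) * jac D₁ D₂ a b := by
  simp only [jac, Derivation.leibniz_inv, smul_eq_mul]
  ring

lemma jac_pow_mul_self (a b : M) (e : ℕ) :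
    jac D₁ D₂ a (a ^ e * b) = a ^ e * jac D₁ D₂ a b := by
  induction e with
  | zero => simp
  | succ e ih => rw [pow_succ', mul_assoc, jac_mul_self, ih, mul_assoc]

lemma jac_infty (a b : M) (e : ℕ) :
    jac D₁ D₂ a⁻¹ (a⁻¹ ^ e * b) = -(a⁻¹ ^ (2 + e)) * jac D₁ D₂ a b := by
  rw [jac_pow_mul_self, jac_inv_left]
  ring

variable {w : Valuation M ℤᵐ⁰}

lemma valuation_jac_inv_right {a b : M} (hb : b ≠ 0) :
    w (jac D₁ D₂ a b) = w (jac D₁ D₂ a b⁻¹) * w b ^ 2 := by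
  rw [jac_inv_right, map_mul, Valuation.map_neg, map_pow, map_inv₀]
  have : w b ≠ 0 := by simpa using hb
  field_simp

lemma valuation_jac_infty {a : M} (ha : a ≠ 0) (b : M) (e : ℕ) :
    w (jac D₁ D₂ a b) = w (jac D₁ D₂ a⁻¹ (a⁻¹ ^ e * b)) * w a ^ (2 + e) := by
  rw [jac_infty, map_mul, Valuation.map_neg, map_pow, map_inv₀]
  have : w a ≠ 0 := by simpa using ha
  rw [mul_comm (_ ^ _) (w (jac D₁ D₂ a b)), mul_assoc, ← mul_pow, inv_mul_cancel₀ this, one_pow,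
    mul_one]

lemma IsPlace.ruled_chart (hw : IsPlace w D₁ D₂) {u a b : M} {F G : ℂ[X][X]} {m n : ℕ}
    (hu : w u = 1) (ha : w a ≤ 1) (hJ : jac D₁ D₂ a b ≠ 0) (hFG : ev a b F = u * ev a b G)
    (hF : F.natDegree ≤ n) (hG : G.natDegree ≤ n) (hmn : 2 * m ≤ n)
    (h1 : w b ≤ 1 → w (ev a b F) < 1 → w (ev a b G) < 1 →
      ∃ c₁ c₂ : ℂ, w (a - algebraMap ℂ M c₁) < 1 ∧ w (b - algebraMap ℂ M c₂) < 1)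
    (h2 : w b⁻¹ < 1 → w (ev a b⁻¹ (reflect n F)) < 1 → w (ev a b⁻¹ (reflect n G)) < 1 →
      ∃ c₁ : ℂ, w (a - algebraMap ℂ M c₁) < 1)
    (hm1 : ∀ c₁ c₂ : ℂ, PairMultLE F G m c₁ c₂)
    (hm2 : ∀ c₁ : ℂ, PairMultLE (reflect n F) (reflect n G) m c₁ 0) :
    w (jac D₁ D₂ a b) ^ n ≤ w (ev a b G) ^ 2 := by
  rcases le_or_gt (w b) 1 with hb | hb
  · calc w (jac D₁ D₂ a b) ^ n ≤ w (jac D₁ D₂ a b) ^ (m * 2) :=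
          pow_le_pow_right_of_le_one' (hw.jac_le ha hb) (by omega)
      _ ≤ w (ev a b G) ^ 2 := by
          rw [pow_mul]
          exact pow_le_pow_left' (hw.chart hu ha hb hJ hFG (h1 hb) fun c₁ c₂ _ _ => hm1 c₁ c₂) 2
  · have hb0 : b ≠ 0 := by rintro rfl; simp at hb
    have hwb : w b ≠ 0 := by simpa using hb0
    have hb' : w b⁻¹ < 1 := by rw [map_inv₀]; exact inv_lt_one_of_one_lt₀ hb
    have hJ' : jac D₁ D₂ a b⁻¹ ≠ 0 := by
      rw [jac_inv_right]
      exact mul_ne_zero (neg_ne_zero.mpr (pow_ne_zero _ (inv_ne_zero hb0))) hJ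
    have hFG' : ev a b⁻¹ (reflect n F) = u * ev a b⁻¹ (reflect n G) := by
      apply mul_right_cancel₀ (pow_ne_zero n hb0)
      rw [mul_assoc, ev_reflect a hb0 hF, ev_reflect a hb0 hG, hFG]
    have key := hw.chart hu ha hb'.le hJ' hFG'
      (fun hF' hG' => by
        obtain ⟨c₁, hc₁⟩ := h2 hb' hF' hG'
        exact ⟨c₁, 0, hc₁, by simpa using hb'⟩)
      (fun c₁ c₂ _ hc₂ => by
        rw [hw.const_eq_zero hb' hc₂]
        exact hm2 c₁)
    rw [← ev_reflect a hb0 hG, valuation_jac_inv_right hb0, map_mul, map_pow, mul_pow, mul_pow]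
    have : w (jac D₁ D₂ a b⁻¹) ^ n ≤ w (ev a b⁻¹ (reflect n G)) ^ 2 :=
      calc _ ≤ w (jac D₁ D₂ a b⁻¹) ^ (m * 2) :=
            pow_le_pow_right_of_le_one' (hw.jac_le ha hb'.le) (by omega)
        _ ≤ _ := by
            rw [pow_mul]
            exact pow_le_pow_left' key 2
    calc _ ≤ w (ev a b⁻¹ (reflect n G)) ^ 2 * (w b ^ 2) ^ n := mul_le_mul_left this _
      _ = _ := by rw [← pow_mul, ← pow_mul, mul_comm 2 n]

/-- On a Hirzebruch surface, a pencil compatible with the Jacobian inequalities has a point of high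
multiplicity. -/
lemma HasPlaces.exists_not_pairMultLE_ruled {u a b : M} (hM : HasPlaces M u)
    (hab : IntermediateField.adjoin ℂ {a, b} = ⊤)
    {F G : ℂ[X][X]} {n e B : ℕ} (hn : 0 < n)
    (hFG : ev a b F = u * ev a b G) (hG0 : ev a b G ≠ 0) (hrel : IsRelPrime F G)
    (hF : F.natDegree ≤ n) (hG : G.natDegree ≤ n) (hFGn : F.coeff n ≠ 0 ∨ G.coeff n ≠ 0)
    (hFB : WeightLE e B F) (hGB : WeightLE e B G) (hB : AttainsWeight e B F ∨ AttainsWeight e B G)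
    (hnB : n * (2 + e) ≤ 2 * B) :
    ((∃ c₁ c₂, ¬ PairMultLE F G (n / 2) c₁ c₂) ∨
      ∃ c₁, ¬ PairMultLE (reflect n F) (reflect n G) (n / 2) c₁ 0) ∨
    ((∃ c₁ c₂, ¬ PairMultLE (inftyTransform e B F) (inftyTransform e B G) (n / 2) c₁ c₂) ∨
      ∃ c₁, ¬ PairMultLE (reflect n (inftyTransform e B F)) (reflect n (inftyTransform e B G))
        (n / 2) c₁ 0) := by
  by_contra hcon
  push Not at hcon
  obtain ⟨⟨hm1, hm2⟩, hm3, hm4⟩ := hcon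
  obtain ⟨w, D₁, D₂, hw, hu, hJ, hlt⟩ := hM a b _ hab hG0 n 2 hn
  refine hlt.not_ge ?_
  rcases le_or_gt (w a) 1 with ha | ha
  · refine hw.ruled_chart hu ha hJ hFG hF hG (by omega)
      (fun hb => hw.exists_const_of_isRelPrime ha hb hrel) (fun hb hF' hG' => ?_) hm1 hm2
    obtain ⟨c₁, c₂, h₁, h₂⟩ := hw.exists_const_of_lt (F := Bivariate.swap (reflect n F))
      (G := Bivariate.swap (reflect n G)) hb ha
      (by simpa [swap_map_eval_zero, coeff_reflect, revAt_le] using hFGn)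
      (by rwa [ev_swap]) (by rwa [ev_swap])
    exact ⟨c₂, h₂⟩
  · have ha0 : a ≠ 0 := by rintro rfl; simp at ha
    have ha' : w a⁻¹ < 1 := by rw [map_inv₀]; exact inv_lt_one_of_one_lt₀ ha
    have hJ' : jac D₁ D₂ a⁻¹ (a⁻¹ ^ e * b) ≠ 0 := by
      rw [jac_infty]
      exact mul_ne_zero (neg_ne_zero.mpr (pow_ne_zero _ (inv_ne_zero ha0))) hJ
    have hFG' : ev a⁻¹ (a⁻¹ ^ e * b) (inftyTransform e B F) =
        u * ev a⁻¹ (a⁻¹ ^ e * b) (inftyTransform e B G) := by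
      apply mul_right_cancel₀ (pow_ne_zero B ha0)
      rw [mul_assoc, ev_inftyTransform ha0 _ hFB, ev_inftyTransform ha0 _ hGB, hFG]
    have key := hw.ruled_chart hu ha'.le hJ' hFG' (natDegree_inftyTransform_le e B hF)
      (natDegree_inftyTransform_le e B hG) (by omega)
      (fun hb => hw.exists_const_of_lt ha' hb
        (hB.imp inftyTransform_map_eval_zero_ne_zero inftyTransform_map_eval_zero_ne_zero))
      (fun _ _ _ => ⟨0, by simpa using ha'⟩) hm3 hm4
    rw [← ev_inftyTransform ha0 b hGB, valuation_jac_infty ha0 b e, map_mul, map_pow, mul_pow,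
      mul_pow, ← pow_mul, ← pow_mul]
    exact mul_le_mul' key (pow_le_pow_right' ha.le (by linarith))

lemma IsPlace.projective_chart (hw : IsPlace w D₁ D₂) {u a b : M} {F G : ℂ[X][X]} {d : ℕ}
    (hu : w u = 1) (ha : 1 < w a) (hab : w b ≤ w a) (hJ : jac D₁ D₂ a b ≠ 0)
    (hFG : ev a b F = u * ev a b G) (hFd : WeightLE 1 d F) (hGd : WeightLE 1 d G)
    (hd : AttainsWeight 1 d F ∨ AttainsWeight 1 d G)
    (hm : ∀ c₁ c₂, PairMultLE (inftyTransform 1 d F) (inftyTransform 1 d G) (d / 3) c₁ c₂) :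
    w (jac D₁ D₂ a b) ^ d ≤ w (ev a b G) ^ 3 := by
  have ha0 : a ≠ 0 := by rintro rfl; simp at ha
  have hwa : w a ≠ 0 := by simpa using ha0
  have ha' : w a⁻¹ < 1 := by rw [map_inv₀]; exact inv_lt_one_of_one_lt₀ ha
  have hb' : w (a⁻¹ ^ 1 * b) ≤ 1 := by
    rw [pow_one, map_mul, map_inv₀, ← div_eq_inv_mul]
    exact div_le_one_of_le₀ hab zero_le
  have hJ' : jac D₁ D₂ a⁻¹ (a⁻¹ ^ 1 * b) ≠ 0 := by
    rw [jac_infty]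
    exact mul_ne_zero (neg_ne_zero.mpr (pow_ne_zero _ (inv_ne_zero ha0))) hJ
  have hFG' : ev a⁻¹ (a⁻¹ ^ 1 * b) (inftyTransform 1 d F) =
      u * ev a⁻¹ (a⁻¹ ^ 1 * b) (inftyTransform 1 d G) := by
    apply mul_right_cancel₀ (pow_ne_zero d ha0)
    rw [mul_assoc, ev_inftyTransform ha0 _ hFd, ev_inftyTransform ha0 _ hGd, hFG]
  have key := hw.chart hu ha'.le hb' hJ' hFG'
    (hw.exists_const_of_lt ha' hb'
      (hd.imp inftyTransform_map_eval_zero_ne_zero inftyTransform_map_eval_zero_ne_zero))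
    (fun c₁ c₂ _ _ => hm c₁ c₂)
  rw [← ev_inftyTransform ha0 b hGd, valuation_jac_infty ha0 b 1, map_mul, map_pow, mul_pow,
    mul_pow, ← pow_mul, ← pow_mul]
  refine mul_le_mul' ?_ (pow_le_pow_right' ha.le (by linarith))
  calc _ ≤ w (jac D₁ D₂ a⁻¹ (a⁻¹ ^ 1 * b)) ^ (d / 3 * 3) :=
        pow_le_pow_right_of_le_one' (hw.jac_le ha'.le hb') (by omega)
    _ ≤ _ := by
        rw [pow_mul]
        exact pow_le_pow_left' key 3

/-- On the projective plane, a pencil compatible with the Jacobian inequalities has a point of high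
multiplicity. -/
lemma HasPlaces.exists_not_pairMultLE_projective {u a b : M} (hM : HasPlaces M u)
    (hab : IntermediateField.adjoin ℂ {a, b} = ⊤)
    {F G : ℂ[X][X]} {d : ℕ} (hd0 : 0 < d)
    (hFG : ev a b F = u * ev a b G) (hG0 : ev a b G ≠ 0) (hrel : IsRelPrime F G)
    (hFd : WeightLE 1 d F) (hGd : WeightLE 1 d G)
    (hd : AttainsWeight 1 d F ∨ AttainsWeight 1 d G) :
    (∃ c₁ c₂, ¬ PairMultLE F G (d / 3) c₁ c₂) ∨
    (∃ c₁ c₂, ¬ PairMultLE (inftyTransform 1 d F) (inftyTransform 1 d G) (d / 3) c₁ c₂) ∨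
    ∃ c₁ c₂, ¬ PairMultLE (inftyTransform 1 d (Bivariate.swap F))
      (inftyTransform 1 d (Bivariate.swap G)) (d / 3) c₁ c₂ := by
  by_contra hcon
  push Not at hcon
  obtain ⟨hm1, hm2, hm3⟩ := hcon
  obtain ⟨w, D₁, D₂, hw, hu, hJ, hlt⟩ := hM a b _ hab hG0 d 3 hd0
  refine hlt.not_ge ?_
  by_cases h1 : w a ≤ 1 ∧ w b ≤ 1
  · calc _ ≤ w (jac D₁ D₂ a b) ^ (d / 3 * 3) :=
          pow_le_pow_right_of_le_one' (hw.jac_le h1.1 h1.2) (by omega)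
      _ ≤ _ := by
        rw [pow_mul]
        exact pow_le_pow_left' (hw.chart hu h1.1 h1.2 hJ hFG
          (hw.exists_const_of_isRelPrime h1.1 h1.2 hrel) fun c₁ c₂ _ _ => hm1 c₁ c₂) 3
  rcases le_total (w b) (w a) with hba | hba
  · exact hw.projective_chart hu (by by_contra h; exact h1 ⟨not_lt.mp h, hba.trans (not_lt.mp h)⟩)
      hba hJ hFG hFd hGd hd hm2
  · have := hw.projective_chart (a := b) (b := a) (F := Bivariate.swap F)
      (G := Bivariate.swap G) hu
      (by by_contra h; exact h1 ⟨hba.trans (not_lt.mp h), not_lt.mp h⟩)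
      hba (by rwa [jac_swap, neg_ne_zero]) (by rwa [ev_swap, ev_swap]) hFd.swap hGd.swap
      (hd.imp AttainsWeight.swap AttainsWeight.swap) hm3
    rwa [jac_swap, Valuation.map_neg, ev_swap] at this

end

end PlaneCremona

namespace PlaneCremona

open Polynomial

/-- The `y`-degree of `F` is at most `n` and all monomials `x ^ i * y ^ j` of `F` satisfy
`i + e * j ≤ B`. -/
def InBox (n e B : ℕ) (F : ℂ[X][X]) : Prop := F.natDegree ≤ n ∧ WeightLE e B F

lemma weightLE_taylorX {e B : ℕ} {F : ℂ[X][X]} (h : WeightLE e B F) (c : ℂ) :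
    WeightLE e B (taylorX c F) := by
  intro i j hij
  have hco : (taylorX c F).coeff j = taylor c (F.coeff j) := by
    rw [taylorX, coeff_map]
    rfl
  rw [hco] at hij
  have hi := le_natDegree_of_ne_zero hij
  rw [natDegree_taylor] at hi
  have hj : F.coeff j ≠ 0 := by
    intro h0
    simp [h0] at hij
  have := h _ _ (show (F.coeff j).coeff (F.coeff j).natDegree ≠ 0 by simpa using hj)
  omega

lemma coeff_taylor_C (c : ℂ) (F : ℂ[X][X]) (i j : ℕ) :
    ((taylor (C c) F).coeff j).coeff i =
      F.sum fun k p => p.coeff i * (c ^ (k - j) * (k.choose j : ℂ)) := by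
  rw [taylor_apply, comp, eval₂_eq_sum, Polynomial.sum, Polynomial.sum, finsetSum_coeff,
    finsetSum_coeff]
  refine Finset.sum_congr rfl fun k _ => ?_
  rw [coeff_C_mul, coeff_X_add_C_pow, ← C_pow, ← C_eq_natCast, ← C_mul, coeff_mul_C]

lemma weightLE_taylor {e B : ℕ} {F : ℂ[X][X]} (h : WeightLE e B F) (c : ℂ) :
    WeightLE e B (taylor (C c) F) := by
  intro i j hij
  rw [coeff_taylor_C] at hij
  obtain ⟨k, -, hk⟩ := Finset.exists_ne_zero_of_sum_ne_zero hij
  have h1 := h _ _ (left_ne_zero_of_mul hk)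
  have h2 : j ≤ k := by
    by_contra hlt
    exact hk (by simp [Nat.choose_eq_zero_of_lt (not_le.mp hlt)])
  have := Nat.mul_le_mul_left e h2
  omega

lemma InBox.translate {n e B : ℕ} {F : ℂ[X][X]} (h : InBox n e B F) (c₁ c₂ : ℂ) :
    InBox n e B (translate c₁ c₂ F) := by
  refine ⟨?_, weightLE_taylor (weightLE_taylorX h.2 c₁) c₂⟩
  rw [translate_apply, natDegree_taylor]
  exact natDegree_map_le.trans h.1

lemma InBox.inftyTransform {n e B : ℕ} {F : ℂ[X][X]} (h : InBox n e B F) :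
    InBox n e B (inftyTransform e B F) :=
  ⟨natDegree_inftyTransform_le e B h.1, h.2.inftyTransform⟩

lemma InBox.reflect {n B : ℕ} {F : ℂ[X][X]} (h : InBox n 0 B F) :
    InBox n 0 B (reflect n F) := by
  refine ⟨natDegree_reflect_le_of_le h.1, fun i j hij => ?_⟩
  rw [coeff_reflect] at hij
  simpa using h.2 _ _ hij

lemma reflect_translate (n : ℕ) (c : ℂ) (F : ℂ[X][X]) :
    reflect n (translate c 0 F) = translate c 0 (reflect n F) := by
  simp only [translate_apply, map_zero, taylor_zero, taylorX, reflect_map]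

lemma natDegree_swap_le {B : ℕ} {F : ℂ[X][X]} (h : WeightLE 0 B F) :
    (Bivariate.swap F).natDegree ≤ B := by
  rw [natDegree_le_iff_coeff_eq_zero]
  intro i hi
  ext j
  rw [coeff_swap, coeff_zero]
  by_contra h0
  have := h _ _ h0
  omega

lemma WeightLE.natDegree_le {B : ℕ} {F : ℂ[X][X]} (h : WeightLE 1 B F) : F.natDegree ≤ B := by
  rw [natDegree_le_iff_coeff_eq_zero]
  intro j hj
  ext i
  by_contra h0
  have := h _ _ h0
  omega

lemma WeightLE.of_mul_left {e B : ℕ} {H F : ℂ[X][X]} (hH : H ≠ 0) (h : WeightLE e B (H * F)) :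
    WeightLE e B F := by
  let Φ : ℂ[X][X] →+* ℂ[X][X] :=
    (Bivariate.swap (R := ℂ) : ℂ[X][X] →+* ℂ[X][X]).comp (compRingHom (C (X ^ e) * X))
  have hco : ∀ (P : ℂ[X][X]) (i j : ℕ),
      ((Φ P).coeff i).coeff j = (P.coeff j * (X ^ e) ^ j).coeff i := by
    intro P i j
    change ((Bivariate.swap (P.comp (C (X ^ e) * X))).coeff i).coeff j = _
    rw [coeff_swap, comp_C_mul_X_coeff]
  have hinj : ∀ P : ℂ[X][X], Φ P = 0 → P = 0 := by
    intro P hP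
    ext j : 1
    have : P.coeff j * (X ^ e) ^ j = 0 := by
      ext i
      rw [← hco, hP]
      simp
    simpa using this
  have hiff : ∀ P : ℂ[X][X], WeightLE e B P ↔ (Φ P).natDegree ≤ B := by
    intro P
    rw [natDegree_le_iff_coeff_eq_zero]
    constructor
    · intro h i hi
      ext j
      rw [hco, ← pow_mul, coeff_mul_X_pow', coeff_zero]
      split_ifs with hij
      · by_contra h0
        have := h _ _ h0
        omega
      · rfl
    · intro h i j hij
      by_contra hlt
      apply hij
      have := congrArg (fun p => coeff p j) (h (i + e * j) (not_le.mp hlt))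
      simpa only [hco, ← pow_mul, coeff_mul_X_pow, coeff_zero] using this
  by_cases hF : F = 0
  · intro i j hij
    simp [hF] at hij
  rw [hiff, map_mul, natDegree_mul (fun h => hH (hinj _ h)) (fun h => hF (hinj _ h))] at h
  rw [hiff]
  omega

lemma InBox.of_mul_left {n e B : ℕ} {H F : ℂ[X][X]} (hH : H ≠ 0) (h : InBox n e B (H * F)) :
    InBox n e B F := by
  refine ⟨?_, h.2.of_mul_left hH⟩
  by_cases hF : F = 0
  · simp [hF]
  have := h.1
  rw [natDegree_mul hH hF] at this
  omega

lemma exists_attainsWeight {e B : ℕ} {F G : ℂ[X][X]} (hF : WeightLE e B F) (hG : WeightLE e B G)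
    (hG0 : G ≠ 0) : ∃ B' ≤ B, WeightLE e B' F ∧ WeightLE e B' G ∧
      (AttainsWeight e B' F ∨ AttainsWeight e B' G) := by
  classical
  have hex : ∃ b, WeightLE e b F ∧ WeightLE e b G := ⟨B, hF, hG⟩
  refine ⟨Nat.find hex, Nat.find_min' hex ⟨hF, hG⟩, (Nat.find_spec hex).1,
    (Nat.find_spec hex).2, ?_⟩
  by_contra hcon
  rw [not_or] at hcon
  obtain ⟨h1, h2⟩ := hcon
  have hlt : ∀ P : ℂ[X][X], WeightLE e (Nat.find hex) P → ¬ AttainsWeight e (Nat.find hex) P →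
      ∀ i j, (P.coeff j).coeff i ≠ 0 → i + e * j < Nat.find hex :=
    fun P hP hP' i j hij => lt_of_le_of_ne (hP _ _ hij) fun h => hP' ⟨i, j, h, hij⟩
  have hpos : 0 < Nat.find hex := by
    have hl : G.coeff G.natDegree ≠ 0 := by simpa using hG0
    have := hlt G (Nat.find_spec hex).2 h2 (G.coeff G.natDegree).natDegree G.natDegree
      (by simpa using hl)
    omega
  refine Nat.find_min hex (Nat.sub_lt hpos one_pos) ⟨fun i j hij => ?_, fun i j hij => ?_⟩
  · have := hlt F (Nat.find_spec hex).1 h1 i j hij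
    omega
  · have := hlt G (Nat.find_spec hex).2 h2 i j hij
    omega

lemma coeff_blowup {F F₁ : ℂ[X][X]} {m : ℕ} (h : ∀ j, X ^ m * F₁.coeff j = F.coeff j * X ^ j)
    {i j : ℕ} (hij : (F₁.coeff j).coeff i ≠ 0) :
    j ≤ i + m ∧ (F.coeff j).coeff (i + m - j) ≠ 0 := by
  have := congrArg (fun p => coeff p (i + m)) (h j)
  simp only [coeff_X_pow_mul, coeff_mul_X_pow'] at this
  rw [this] at hij
  split_ifs at hij with hj
  · exact ⟨hj, hij⟩
  · exact absurd rfl hij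

lemma natDegree_blowup_le {F F₁ : ℂ[X][X]} {m n : ℕ}
    (h : ∀ j, X ^ m * F₁.coeff j = F.coeff j * X ^ j) (hF : F.natDegree ≤ n) :
    F₁.natDegree ≤ n := by
  rw [natDegree_le_iff_coeff_eq_zero]
  intro j hj
  have := h j
  rw [coeff_eq_zero_of_natDegree_lt (hF.trans_lt hj), zero_mul] at this
  simpa using this

/-- `ev (g X0) (g X1)` maps the pair `(F, G)` to a representation of `X0` as a fraction. -/
structure IsPencil (g : Cremona2) (F G : ℂ[X][X]) : Prop where
  ne_zero : G ≠ 0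
  eq : ev (g X0) (g X1) F = X0 * ev (g X0) (g X1) G

lemma ev_X0_X1 (F : ℂ[X][X]) :
    ev X0 X1 F = algebraMap (MvPolynomial (Fin 2) ℂ) K2 (Bivariate.equivMvPolynomial ℂ F) := by
  induction F using Polynomial.induction_on' with
  | add p q hp hq => simp only [map_add, hp, hq]
  | monomial n p =>
    rw [← C_mul_X_pow_eq_monomial]
    simp only [map_mul, map_pow, ev_X, Bivariate.equivMvPolynomial_X, ev_C, X1]
    congr 1
    induction p using Polynomial.induction_on' with
    | add p q hp hq => simp only [map_add, hp, hq]
    | monomial n c =>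
      rw [← C_mul_X_pow_eq_monomial]
      simp only [map_mul, map_pow, aeval_C, aeval_X, Bivariate.equivMvPolynomial_C_X, X0,
        Bivariate.equivMvPolynomial_C_C]
      rw [IsScalarTower.algebraMap_apply ℂ (MvPolynomial (Fin 2) ℂ) K2]
      rfl

lemma ev_apply (g : Cremona2) (F : ℂ[X][X]) : ev (g X0) (g X1) F = g (ev X0 X1 F) := by
  induction F using Polynomial.induction_on' with
  | add p q hp hq => simp only [map_add, hp, hq]
  | monomial n p =>
    rw [← C_mul_X_pow_eq_monomial]
    simp only [map_mul, map_pow, ev_X, ev_C]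
    rw [show g X0 = g.toAlgHom X0 from rfl, aeval_algHom_apply]
    rfl

lemma ev_apply_ne_zero (g : Cremona2) {F : ℂ[X][X]} (hF : F ≠ 0) : ev (g X0) (g X1) F ≠ 0 := by
  rw [ev_apply, ev_X0_X1]
  simpa using hF

lemma exists_isPencil (g : Cremona2) : ∃ F G, IsPencil g F G := by
  obtain ⟨p, q, hq, h⟩ := IsFractionRing.div_surjective (A := MvPolynomial (Fin 2) ℂ) (g⁻¹ X0)
  have hq0 : q ≠ 0 := nonZeroDivisors.ne_zero hq
  have hq0' : algebraMap (MvPolynomial (Fin 2) ℂ) K2 q ≠ 0 := by simpa using hq0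
  refine ⟨(Bivariate.equivMvPolynomial ℂ).symm p, (Bivariate.equivMvPolynomial ℂ).symm q,
    by simpa using hq0, ?_⟩
  rw [ev_apply, ev_apply, ev_X0_X1, ev_X0_X1, AlgEquiv.apply_symm_apply,
    AlgEquiv.apply_symm_apply, (div_eq_iff hq0').mp h, map_mul]
  congr 1
  exact g.apply_symm_apply X0

lemma IsPencil.transfer {g g' : Cremona2} {F G F' G' : ℂ[X][X]} (h : IsPencil g F G) {s : K2}
    (hs : s ≠ 0) (hF : s * ev (g' X0) (g' X1) F' = ev (g X0) (g X1) F)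
    (hG : s * ev (g' X0) (g' X1) G' = ev (g X0) (g X1) G) : IsPencil g' F' G' where
  ne_zero := by
    rintro rfl
    exact ev_apply_ne_zero g h.ne_zero (by rw [← hG, map_zero, mul_zero])
  eq := by
    apply mul_left_cancel₀ hs
    rw [mul_left_comm, hF, hG, h.eq]

lemma IsPencil.exists_isRelPrime {g : Cremona2} {F G : ℂ[X][X]} (h : IsPencil g F G) :
    ∃ F' G' H, IsRelPrime F' G' ∧ H ≠ 0 ∧ H * F' = F ∧ H * G' = G ∧ IsPencil g F' G' := by
  obtain ⟨F', G', H, hrel, hF, hG⟩ :=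
    UniqueFactorizationMonoid.exists_reduced_factors' F G h.ne_zero
  have hH : H ≠ 0 := by
    rintro rfl
    exact h.ne_zero (by rw [← hG, zero_mul])
  exact ⟨F', G', H, hrel, hH, hF, hG, h.transfer (ev_apply_ne_zero g hH)
    (by rw [← map_mul, hF]) (by rw [← map_mul, hG])⟩

end PlaneCremona

namespace PlaneCremona

open Polynomial

variable {N : Subgroup Cremona2}

lemma apply_X0_ne_zero (g : Cremona2) : g X0 ≠ 0 := by simpa using X0_ne_zero

lemma apply_X1_ne_zero (g : Cremona2) : g X1 ≠ 0 := by simpa using X1_ne_zero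

lemma exists_of_move {a b : K2} (h : ∃ m ∈ N, m X0 = a ∧ m X1 = b) (g : Cremona2) :
    ∃ g' : Cremona2, g' X0 = g a ∧ g' X1 = g b ∧ (g' ∈ N → g ∈ N) := by
  obtain ⟨m, hm, h0, h1⟩ := h
  exact ⟨g * m, by rw [AlgEquiv.mul_apply, h0], by rw [AlgEquiv.mul_apply, h1],
    (N.mul_mem_cancel_right hm).mp⟩

variable [N.Normal] {g : Cremona2} {F G : ℂ[X][X]}

lemma IsPencil.swap (hN : ContainsTranslations N) (h : IsPencil g F G) :
    ∃ g', IsPencil g' (Bivariate.swap F) (Bivariate.swap G) ∧ (g' ∈ N → g ∈ N) := by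
  obtain ⟨s, hs0, hs1⟩ := exists_swap
  obtain ⟨g', h0, h1, hg⟩ := exists_of_move ⟨s, hN.swap_mem hs0 hs1, hs0, hs1⟩ g
  exact ⟨g', h.transfer one_ne_zero (by rw [h0, h1, ev_swap, one_mul])
    (by rw [h0, h1, ev_swap, one_mul]), hg⟩

lemma IsPencil.translate (hN : ContainsTranslations N) (h : IsPencil g F G) (c₁ c₂ : ℂ) :
    ∃ g', IsPencil g' (translate c₁ c₂ F) (translate c₁ c₂ G) ∧ (g' ∈ N → g ∈ N) := by
  obtain ⟨m₁, hm₁, h₁0, h₁1⟩ := hN.moebius_left (α := 1) (β := -c₁) (γ := 0) (δ := 1) (by simp)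
  obtain ⟨m₂, hm₂, h₂0, h₂1⟩ := hN _ (IntermediateField.algebraMap_mem Fx (-c₂))
  have h0 : (m₁ * m₂) X0 = X0 - algebraMap ℂ K2 c₁ := by
    rw [AlgEquiv.mul_apply, h₂0, h₁0]
    simp [sub_eq_add_neg]
  have h1 : (m₁ * m₂) X1 = X1 - algebraMap ℂ K2 c₂ := by
    rw [AlgEquiv.mul_apply, h₂1, map_add, h₁1, AlgEquiv.commutes, map_neg, sub_eq_add_neg]
  obtain ⟨g', h0', h1', hg⟩ := exists_of_move ⟨_, mul_mem hm₁ hm₂, h0, h1⟩ g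
  rw [map_sub, AlgEquiv.commutes] at h0' h1'
  exact ⟨g', h.transfer one_ne_zero (by rw [h0', h1', ev_translate, one_mul])
    (by rw [h0', h1', ev_translate, one_mul]), hg⟩

lemma IsPencil.infty (hN : ContainsTranslations N) (h : IsPencil g F G) {e B : ℕ}
    (hF : WeightLE e B F) (hG : WeightLE e B G) :
    ∃ g', IsPencil g' (inftyTransform e B F) (inftyTransform e B G) ∧ (g' ∈ N → g ∈ N) := by
  obtain ⟨m₁, hm₁, h₁0, h₁1⟩ := hN.moebius_left (α := 0) (β := 1) (γ := 1) (δ := 0) (by simp)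
  obtain ⟨m₂, hm₂, h₂0, h₂1⟩ := hN.mul (pow_mem X0_mem e) (pow_ne_zero e X0_ne_zero)
  have h0 : (m₁ * m₂) X0 = X0⁻¹ := by
    rw [AlgEquiv.mul_apply, h₂0, h₁0]
    simp
  have h1 : (m₁ * m₂) X1 = X0⁻¹ ^ e * X1 := by
    rw [AlgEquiv.mul_apply, h₂1, map_mul, map_pow, h₁1, h₁0]
    simp
  obtain ⟨g', h0', h1', hg⟩ := exists_of_move ⟨_, mul_mem hm₁ hm₂, h0, h1⟩ g
  rw [map_inv₀] at h0'
  rw [map_mul, map_pow, map_inv₀] at h1'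
  have hg0 := apply_X0_ne_zero g
  exact ⟨g', h.transfer (pow_ne_zero B hg0)
    (by rw [h0', h1', mul_comm, ev_inftyTransform hg0 _ hF])
    (by rw [h0', h1', mul_comm, ev_inftyTransform hg0 _ hG]), hg⟩

lemma IsPencil.reflect (hN : ContainsTranslations N) (h : IsPencil g F G) {n : ℕ}
    (hF : F.natDegree ≤ n) (hG : G.natDegree ≤ n) :
    ∃ g', IsPencil g' (reflect n F) (reflect n G) ∧ (g' ∈ N → g ∈ N) := by
  obtain ⟨g', h0, h1, hg⟩ := exists_of_move hN.inv g
  rw [map_inv₀] at h1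
  have hg1 := apply_X1_ne_zero g
  exact ⟨g', h.transfer (pow_ne_zero n hg1)
    (by rw [h0, h1, mul_comm, ev_reflect _ hg1 hF])
    (by rw [h0, h1, mul_comm, ev_reflect _ hg1 hG]), hg⟩

/-- Blowing up the origin. -/
lemma IsPencil.blowup (hN : ContainsTranslations N) (h : IsPencil g F G) {e B n m : ℕ}
    (hF : InBox n (e + 1) B F) (hG : InBox n (e + 1) B G)
    (hFm : ∀ i j, i + j < m → (F.coeff j).coeff i = 0)
    (hGm : ∀ i j, i + j < m → (G.coeff j).coeff i = 0) :
    m ≤ B ∧ ∃ g' F' G', IsPencil g' F' G' ∧ InBox n e (B - m) F' ∧ InBox n e (B - m) G' ∧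
      (g' ∈ N → g ∈ N) := by
  obtain ⟨F₁, hF₁, hF₁'⟩ := exists_blowup hFm
  obtain ⟨G₁, hG₁, hG₁'⟩ := exists_blowup hGm
  obtain ⟨g', h0, h1, hg⟩ := exists_of_move
    (hN.mul (inv_mem X0_mem) (inv_ne_zero X0_ne_zero)) g
  have hg0 := apply_X0_ne_zero g
  have key : ∀ P P₁ : ℂ[X][X], C (X ^ m) * P₁ = P.comp (C X * X) →
      g X0 ^ m * ev (g' X0) (g' X1) P₁ = ev (g X0) (g X1) P := by
    intro P P₁ hP
    have := congrArg (ev (g' X0) (g' X1)) hP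
    rw [h1, map_mul, map_inv₀, h0]
    rwa [ev_comp_mul, map_mul, ev_C, map_pow, aeval_X, h0, h1, map_mul, map_inv₀,
      mul_inv_cancel_left₀ hg0] at this
  have hpen : IsPencil g' F₁ G₁ := h.transfer (pow_ne_zero m hg0) (key _ _ hF₁) (key _ _ hG₁)
  have hbox : ∀ P P₁ : ℂ[X][X], InBox n (e + 1) B P →
      (∀ j, X ^ m * P₁.coeff j = P.coeff j * X ^ j) →
      ∀ i j, (P₁.coeff j).coeff i ≠ 0 → i + e * j + m ≤ B := by
    intro P P₁ hP hP₁ i j hij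
    obtain ⟨hj, hc⟩ := coeff_blowup hP₁ hij
    have := hP.2 _ _ hc
    rw [add_one_mul] at this
    omega
  have hmB : m ≤ B := by
    have hl : G₁.coeff G₁.natDegree ≠ 0 := by simpa using hpen.ne_zero
    have := hbox _ _ hG hG₁' (G₁.coeff G₁.natDegree).natDegree G₁.natDegree (by simpa using hl)
    omega
  refine ⟨hmB, g', F₁, G₁, hpen, ⟨natDegree_blowup_le hF₁' hF.1, fun i j hij => ?_⟩,
    ⟨natDegree_blowup_le hG₁' hG.1, fun i j hij => ?_⟩, hg⟩
  · have := hbox _ _ hF hF₁' i j hij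
    omega
  · have := hbox _ _ hG hG₁' i j hij
    omega

/-- Blowing up the point at infinity of the line `x = 0`. -/
lemma IsPencil.blowup_reflect (hN : ContainsTranslations N) (h : IsPencil g F G) {e B n m : ℕ}
    (hF : InBox n e B F) (hG : InBox n e B G)
    (hFm : ∀ i j, i + j < m → ((Polynomial.reflect n F).coeff j).coeff i = 0)
    (hGm : ∀ i j, i + j < m → ((Polynomial.reflect n G).coeff j).coeff i = 0) :
    m ≤ B + n ∧ ∃ g' F' G', IsPencil g' F' G' ∧ InBox n (e + 1) (B + n - m) F' ∧
      InBox n (e + 1) (B + n - m) G' ∧ (g' ∈ N → g ∈ N) := by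
  obtain ⟨F₁, hF₁, hF₁'⟩ := exists_blowup hFm
  obtain ⟨G₁, hG₁, hG₁'⟩ := exists_blowup hGm
  obtain ⟨g', h0, h1, hg⟩ := exists_of_move (hN.mul X0_mem X0_ne_zero) g
  have hg0 := apply_X0_ne_zero g
  have hg1 := apply_X1_ne_zero g
  have hg1' := apply_X1_ne_zero g'
  have key : ∀ P P₁ : ℂ[X][X], P.natDegree ≤ n →
      C (X ^ m) * P₁ = (Polynomial.reflect n P).comp (C X * X) →
      (∀ j, X ^ m * P₁.coeff j = (Polynomial.reflect n P).coeff j * X ^ j) →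
      (g X0 ^ m * (g X1 ^ n * (g' X1)⁻¹ ^ n)) *
        ev (g' X0) (g' X1) (Polynomial.reflect n P₁) = ev (g X0) (g X1) P := by
    intro P P₁ hP h₁ h₁'
    have h2 := natDegree_blowup_le h₁' (natDegree_reflect_le_of_le hP)
    have h3 := ev_reflect (g' X0) (inv_ne_zero hg1') h2
    rw [inv_inv] at h3
    have := congrArg (ev (g' X0) (g' X1)⁻¹) h₁
    rw [ev_comp_mul, map_mul, ev_C, map_pow, aeval_X, ← h3] at this
    rw [h0, show g X0 * (g' X1)⁻¹ = (g X1)⁻¹ by rw [h1, map_mul]; field_simp] at this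
    rw [← ev_reflect _ hg1 hP, ← this, h0]
    ring
  have hpen : IsPencil g' (Polynomial.reflect n F₁) (Polynomial.reflect n G₁) :=
    h.transfer (mul_ne_zero (pow_ne_zero m hg0) (mul_ne_zero (pow_ne_zero n hg1)
      (pow_ne_zero n (inv_ne_zero hg1')))) (key _ _ hF.1 hF₁ hF₁') (key _ _ hG.1 hG₁ hG₁')
  have hdeg : ∀ P P₁ : ℂ[X][X], P.natDegree ≤ n →
      (∀ j, X ^ m * P₁.coeff j = (Polynomial.reflect n P).coeff j * X ^ j) →
      (Polynomial.reflect n P₁).natDegree ≤ n := fun P P₁ hP h₁ =>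
    natDegree_reflect_le_of_le (natDegree_blowup_le h₁ (natDegree_reflect_le_of_le hP))
  have hbox : ∀ P P₁ : ℂ[X][X], InBox n e B P →
      (∀ j, X ^ m * P₁.coeff j = (Polynomial.reflect n P).coeff j * X ^ j) →
      ∀ i j, ((Polynomial.reflect n P₁).coeff j).coeff i ≠ 0 → i + (e + 1) * j + m ≤ B + n := by
    intro P P₁ hP hP₁ i j hij
    have hjn : j ≤ n := by
      refine le_trans (le_natDegree_of_ne_zero fun h0 => hij ?_) (hdeg _ _ hP.1 hP₁)
      rw [h0, coeff_zero]
    rw [coeff_reflect, revAt_le hjn] at hij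
    obtain ⟨hj, hc⟩ := coeff_blowup hP₁ hij
    rw [coeff_reflect, revAt_le (Nat.sub_le _ _), Nat.sub_sub_self hjn] at hc
    have := hP.2 _ _ hc
    rw [add_one_mul]
    omega
  have hmB : m ≤ B + n := by
    have hl : (Polynomial.reflect n G₁).coeff (Polynomial.reflect n G₁).natDegree ≠ 0 := by
      rw [coeff_natDegree]
      exact leadingCoeff_ne_zero.mpr hpen.ne_zero
    have := hbox _ _ hG hG₁' _ _ (coeff_natDegree (p := (Polynomial.reflect n G₁).coeff
      (Polynomial.reflect n G₁).natDegree) ▸ leadingCoeff_ne_zero.mpr hl)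
    omega
  refine ⟨hmB, g', _, _, hpen, ⟨hdeg _ _ hF.1 hF₁', fun i j hij => ?_⟩,
    ⟨hdeg _ _ hG.1 hG₁', fun i j hij => ?_⟩, hg⟩
  · have := hbox _ _ hF hF₁' i j hij
    omega
  · have := hbox _ _ hG hG₁' i j hij
    omega

end PlaneCremona

namespace PlaneCremona

open Polynomial

variable {N : Subgroup Cremona2} {g : Cremona2} {F G : ℂ[X][X]} {n : ℕ}

lemma coeff_eq_zero_of_not_pairMultLE {m : ℕ} {c₁ c₂ : ℂ} (h : ¬ PairMultLE F G m c₁ c₂) :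
    (∀ i j, i + j < m + 1 → ((translate c₁ c₂ F).coeff j).coeff i = 0) ∧
      ∀ i j, i + j < m + 1 → ((translate c₁ c₂ G).coeff j).coeff i = 0 := by
  rw [PairMultLE, not_or] at h
  exact ⟨fun i j hij => not_multLE h.1 (by omega), fun i j hij => not_multLE h.2 (by omega)⟩

/-- Every pencil whose degree on the fibres is less than `n` comes from an element of `N`. -/
def DescendsBelow (N : Subgroup Cremona2) (n : ℕ) : Prop :=
  ∀ (g : Cremona2) (F G : ℂ[X][X]), IsPencil g F G → F.natDegree < n → G.natDegree < n → g ∈ N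

/-- Every pencil of degree `n` on the fibres of a Hirzebruch surface whose excess
`2 * B - n * (2 + e)` is less than `k` comes from an element of `N`. -/
def DescendsExcess (N : Subgroup Cremona2) (n k : ℕ) : Prop :=
  ∀ (g : Cremona2) (F G : ℂ[X][X]) (e B : ℕ), IsPencil g F G → InBox n e B F → InBox n e B G →
    2 * B + 1 ≤ k + n * (2 + e) → g ∈ N

/-- A pencil of degree `n` on the fibres may be assumed to be without fixed component and with
minimal bounds on its monomials. -/
lemma DescendsBelow.descendsExcess_of_reduced (hn : DescendsBelow N n) {k : ℕ}
    (H : ∀ (g : Cremona2) (F G : ℂ[X][X]) (e B : ℕ), IsPencil g F G → InBox n e B F →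
      InBox n e B G → IsRelPrime F G → (F.coeff n ≠ 0 ∨ G.coeff n ≠ 0) →
      (AttainsWeight e B F ∨ AttainsWeight e B G) → 2 * B + 1 ≤ k + n * (2 + e) → g ∈ N) :
    DescendsExcess N n k := by
  intro g F₀ G₀ e B h hF₀ hG₀ hB
  obtain ⟨F, G, P, hrel, hP, rfl, rfl, hpen⟩ := h.exists_isRelPrime
  have hF := hF₀.of_mul_left hP
  have hG := hG₀.of_mul_left hP
  by_cases hFGn : F.coeff n ≠ 0 ∨ G.coeff n ≠ 0
  · obtain ⟨B', hB', hF', hG', hatt⟩ := exists_attainsWeight hF.2 hG.2 hpen.ne_zero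
    exact H g F G e B' hpen ⟨hF.1, hF'⟩ ⟨hG.1, hG'⟩ hrel hFGn hatt (by omega)
  · rw [not_or, not_not, not_not] at hFGn
    rcases Nat.eq_zero_or_pos n with rfl | hn0
    · refine absurd ?_ hpen.ne_zero
      rw [eq_C_of_natDegree_le_zero hG.1, hFGn.2, C_0]
    · have hlt : ∀ Q : ℂ[X][X], Q.natDegree ≤ n → Q.coeff n = 0 → Q.natDegree < n := by
        intro Q hQ hQn
        refine lt_of_le_of_ne hQ fun heq => ?_
        rw [← heq, coeff_natDegree, leadingCoeff_eq_zero] at hQn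
        rw [hQn, natDegree_zero] at heq
        omega
      exact hn g F G hpen (hlt F hF.1 hFGn.1) (hlt G hG.1 hFGn.2)

variable [N.Normal]

/-- The case of a pencil of fibres. -/
lemma IsPencil.mem_of_natDegree_eq_zero (hN : ContainsTranslations N) (h : IsPencil g F G)
    (hF : F.natDegree = 0) (hG : G.natDegree = 0) : g ∈ N := by
  obtain ⟨p, rfl⟩ := natDegree_eq_zero.mp hF
  obtain ⟨q, rfl⟩ := natDegree_eq_zero.mp hG
  have hmem : ∀ q : ℂ[X], aeval X0 q ∈ Fx := fun q =>
    IntermediateField.algebra_adjoin_le_adjoin ℂ _ (aeval_mem_adjoin_singleton ℂ X0)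
  have hq := ev_apply_ne_zero g h.ne_zero
  have heq := h.eq
  rw [ev_apply, ev_apply, ev_C, ev_C] at heq
  rw [ev_apply, ev_C] at hq
  have hq0 : aeval X0 q ≠ 0 := by simpa using hq
  have : g⁻¹ X0 = aeval X0 p / aeval X0 q := by
    apply g.injective
    rw [map_div₀, heq, mul_div_cancel_right₀ _ hq]
    exact g.apply_symm_apply X0
  exact inv_mem_iff.mp (hN.mem_of_X0_mem (this ▸ div_mem (hmem p) (hmem q)))

lemma DescendsBelow.mem_of_not_pairMultLE (hn : DescendsBelow N n) (hN : ContainsTranslations N)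
    (h : IsPencil g F G) {d : ℕ} (hF : WeightLE 1 d F) (hG : WeightLE 1 d G)
    (hd : 2 * d < 3 * n) {c₁ c₂ : ℂ} (hc : ¬ PairMultLE F G (d / 3) c₁ c₂) : g ∈ N := by
  obtain ⟨g₁, h₁, hg₁⟩ := h.translate hN c₁ c₂
  obtain ⟨hm₁, hm₂⟩ := coeff_eq_zero_of_not_pairMultLE hc
  have hbF : InBox d (0 + 1) d F := ⟨hF.natDegree_le, hF⟩
  have hbG : InBox d (0 + 1) d G := ⟨hG.natDegree_le, hG⟩
  obtain ⟨hmd, g₂, F₂, G₂, h₂, hF₂, hG₂, hg₂⟩ :=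
    h₁.blowup hN (hbF.translate c₁ c₂) (hbG.translate c₁ c₂) hm₁ hm₂
  obtain ⟨g₃, h₃, hg₃⟩ := h₂.swap hN
  have hlt : d - (d / 3 + 1) < n := by omega
  exact hg₁ (hg₂ (hg₃ (hn g₃ _ _ h₃ ((natDegree_swap_le hF₂.2).trans_lt hlt)
    ((natDegree_swap_le hG₂.2).trans_lt hlt))))

/-- The case where the pencil lives on the projective plane or on a quadric. -/
lemma DescendsBelow.mem_of_lt (hn : DescendsBelow N n) (hN : ContainsTranslations N)
    (h : IsPencil g F G) (hrel : IsRelPrime F G) {e B : ℕ} (hF : WeightLE e B F)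
    (hG : WeightLE e B G) (hB : AttainsWeight e B F ∨ AttainsWeight e B G)
    (hFGn : F.coeff n ≠ 0 ∨ G.coeff n ≠ 0) (hlt : 2 * B < n * (2 + e)) :
    g ∈ N := by
  have hle : e * n ≤ B := by
    rcases hFGn with h0 | h0
    · have := hF (F.coeff n).natDegree n (by simpa using h0)
      omega
    · have := hG (G.coeff n).natDegree n (by simpa using h0)
      omega
  have he : e < 2 := by
    by_contra he
    nlinarith
  interval_cases e
  · obtain ⟨g₁, h₁, hg₁⟩ := h.swap hN
    exact hg₁ (hn g₁ _ _ h₁ ((natDegree_swap_le hF).trans_lt (by omega))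
      ((natDegree_swap_le hG).trans_lt (by omega)))
  · rcases hasPlaces_X0.exists_not_pairMultLE_projective (adjoin_apply g) (show 0 < B by omega)
      h.eq (ev_apply_ne_zero g h.ne_zero) hrel hF hG hB with
      ⟨c₁, c₂, hc⟩ | ⟨c₁, c₂, hc⟩ | ⟨c₁, c₂, hc⟩
    · exact hn.mem_of_not_pairMultLE hN h hF hG (by omega) hc
    · obtain ⟨g₁, h₁, hg₁⟩ := h.infty hN hF hG
      exact hg₁ (hn.mem_of_not_pairMultLE hN h₁ hF.inftyTransform hG.inftyTransform
        (by omega) hc)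
    · obtain ⟨g₁, h₁, hg₁⟩ := h.swap hN
      obtain ⟨g₂, h₂, hg₂⟩ := h₁.infty hN hF.swap hG.swap
      exact hg₁ (hg₂ (hn.mem_of_not_pairMultLE hN h₂ hF.swap.inftyTransform
        hG.swap.inftyTransform (by omega) hc))

lemma DescendsExcess.mem_of_reflect {k : ℕ} (hk : DescendsExcess N n k)
    (hN : ContainsTranslations N) (h : IsPencil g F G) {e B m : ℕ} (hF : InBox n e B F)
    (hG : InBox n e B G) (hB : 2 * B + 1 ≤ k + 1 + n * (2 + e)) (hm : n < 2 * m)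
    (hFm : ∀ i j, i + j < m → ((reflect n F).coeff j).coeff i = 0)
    (hGm : ∀ i j, i + j < m → ((reflect n G).coeff j).coeff i = 0) : g ∈ N := by
  obtain ⟨hmB, g₁, F₁, G₁, h₁, hF₁, hG₁, hg₁⟩ := h.blowup_reflect hN hF hG hFm hGm
  refine hg₁ (hk g₁ F₁ G₁ _ _ h₁ hF₁ hG₁ ?_)
  rw [← add_assoc, mul_add n _ 1]
  omega

lemma DescendsExcess.mem_of_origin {k : ℕ} (hk : DescendsExcess N n k)
    (hN : ContainsTranslations N) (h : IsPencil g F G) {e B m : ℕ} (hF : InBox n e B F)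
    (hG : InBox n e B G) (hB : 2 * B + 1 ≤ k + 1 + n * (2 + e)) (hm : n < 2 * m)
    (hFm : ∀ i j, i + j < m → (F.coeff j).coeff i = 0)
    (hGm : ∀ i j, i + j < m → (G.coeff j).coeff i = 0) : g ∈ N := by
  cases e with
  | zero =>
    obtain ⟨g₁, h₁, hg₁⟩ := h.reflect hN hF.1 hG.1
    exact hg₁ (hk.mem_of_reflect hN h₁ hF.reflect hG.reflect hB hm
      (by rwa [reflect_reflect]) (by rwa [reflect_reflect]))
  | succ e =>
    obtain ⟨hmB, g₁, F₁, G₁, h₁, hF₁, hG₁, hg₁⟩ := h.blowup hN hF hG hFm hGm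
    refine hg₁ (hk g₁ F₁ G₁ _ _ h₁ hF₁ hG₁ ?_)
    rw [← add_assoc, mul_add n _ 1] at hB
    omega

lemma DescendsExcess.mem_of_not_pairMultLE {k : ℕ} (hk : DescendsExcess N n k)
    (hN : ContainsTranslations N) (h : IsPencil g F G) {e B : ℕ} (hF : InBox n e B F)
    (hG : InBox n e B G) (hB : 2 * B + 1 ≤ k + 1 + n * (2 + e))
    (hc : (∃ c₁ c₂, ¬ PairMultLE F G (n / 2) c₁ c₂) ∨
      ∃ c₁, ¬ PairMultLE (reflect n F) (reflect n G) (n / 2) c₁ 0) : g ∈ N := by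
  rcases hc with ⟨c₁, c₂, hc⟩ | ⟨c₁, hc⟩
  · obtain ⟨g₁, h₁, hg₁⟩ := h.translate hN c₁ c₂
    obtain ⟨hm₁, hm₂⟩ := coeff_eq_zero_of_not_pairMultLE hc
    exact hg₁ (hk.mem_of_origin hN h₁ (hF.translate c₁ c₂) (hG.translate c₁ c₂) hB (by omega)
      hm₁ hm₂)
  · obtain ⟨g₁, h₁, hg₁⟩ := h.translate hN c₁ 0
    obtain ⟨hm₁, hm₂⟩ := coeff_eq_zero_of_not_pairMultLE hc
    rw [← reflect_translate] at hm₁ hm₂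
    exact hg₁ (hk.mem_of_reflect hN h₁ (hF.translate c₁ 0) (hG.translate c₁ 0) hB (by omega)
      hm₁ hm₂)

lemma DescendsBelow.descendsExcess (hn : DescendsBelow N n) (hN : ContainsTranslations N)
    (hn0 : 0 < n) (k : ℕ) : DescendsExcess N n k := by
  induction k with
  | zero =>
    refine hn.descendsExcess_of_reduced fun g F G e B h hF hG hrel hFGn hatt hB => ?_
    exact hn.mem_of_lt hN h hrel hF.2 hG.2 hatt hFGn (by omega)
  | succ k ih =>
    refine hn.descendsExcess_of_reduced fun g F G e B h hF hG hrel hFGn hatt hB => ?_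
    rcases lt_or_ge (2 * B) (n * (2 + e)) with hlt | hge
    · exact hn.mem_of_lt hN h hrel hF.2 hG.2 hatt hFGn hlt
    rcases hasPlaces_X0.exists_not_pairMultLE_ruled (adjoin_apply g) hn0 h.eq
      (ev_apply_ne_zero g h.ne_zero) hrel hF.1 hG.1 hFGn hF.2 hG.2 hatt hge with hc | hc
    · exact ih.mem_of_not_pairMultLE hN h hF hG hB hc
    · obtain ⟨g₁, h₁, hg₁⟩ := h.infty hN hF.2 hG.2
      exact hg₁ (ih.mem_of_not_pairMultLE hN h₁ hF.inftyTransform hG.inftyTransform hB hc)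

lemma ContainsTranslations.descendsBelow (hN : ContainsTranslations N) (n : ℕ) :
    DescendsBelow N n := by
  induction n with
  | zero => exact fun g F G _ hF => absurd hF (Nat.not_lt_zero _)
  | succ n ih =>
    intro g F G h hF hG
    rcases Nat.eq_zero_or_pos n with rfl | hn0
    · exact h.mem_of_natDegree_eq_zero hN (by omega) (by omega)
    have hweight : ∀ P : ℂ[X][X], ∃ B, WeightLE 0 B P := fun P =>
      ⟨(Bivariate.swap P).natDegree, fun i j hij => by
        rw [zero_mul, add_zero]
        refine le_natDegree_of_ne_zero fun h0 => hij ?_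
        rw [← coeff_swap, h0, coeff_zero]⟩
    obtain ⟨B₁, hB₁⟩ := hweight F
    obtain ⟨B₂, hB₂⟩ := hweight G
    exact ih.descendsExcess hN hn0 (2 * max B₁ B₂ + 1) g F G 0 (max B₁ B₂) h
      ⟨by omega, fun i j hij => (hB₁ i j hij).trans (le_max_left _ _)⟩
      ⟨by omega, fun i j hij => (hB₂ i j hij).trans (le_max_right _ _)⟩ (by omega)

theorem ContainsTranslations.eq_top (hN : ContainsTranslations N) : N = ⊤ := by
  rw [Subgroup.eq_top_iff']
  intro g
  obtain ⟨F, G, h⟩ := exists_isPencil g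
  exact hN.descendsBelow (max F.natDegree G.natDegree + 1) g F G h (by omega) (by omega)

end PlaneCremona

/-- For every non-trivial linear (projective) automorphism `A` of `ℙ²_ℂ`, the normal
subgroup of the plane Cremona group generated by `A` is the whole group. -/
theorem normal_closure_of_linear (A : Cremona2) (hA : IsLinearAut A) (hA1 : A ≠ 1) :
    Subgroup.normalClosure {A} = (⊤ : Subgroup Cremona2) := by
  exact (PlaneCremona.containsTranslations_of_linear hA hA1
    (Subgroup.subset_normalClosure (Set.mem_singleton A))).eq_top
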